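/- Every outer local flat folding of a square (with finitely many creases) is realizable as an outer global flat folding. -/

import Mathlib

noncomputable section

open Set

/-- The closed half-plane bounded by the line through `p` with direction `d`,
lying on the counterclockwise side of that line. -/
def closedHalfPlane (p d : ℂ) : Set ℂ := {z : ℂ | 0 ≤ ((z - p) * starRingEnd ℂ d).im}

/-- The closed wedge with apex `p` spanned by the directions with angles in `[α, β]`. -/
def wedge (p : ℂ) (α β : ℝ) : Set ℂ :=
  {z : ℂ | ∃ r : ℝ, 0 ≤ r ∧ ∃ t : ℝ, α ≤ t ∧ t ≤ β ∧ z = p + r * Complex.exp (t * Complex.I)}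

/-- Euclidean three-dimensional space. -/
abbrev Space3 := EuclideanSpace ℝ (Fin 3)

/-- Vertical projection from three-dimensional space to the plane. -/
def proj2 (q : Space3) : ℂ := ⟨q 0, q 1⟩


/-- `p` is an *unfolded point* of the folding `φ` of the sheet `K`: `φ` agrees with a Euclidean
isometry on the intersection of `K` with some neighborhood of `p`. -/
def UnfoldedPtOn (K : Set ℂ) (φ : ℂ → ℂ) (p : ℂ) : Prop :=
  ∃ U ∈ nhds p, ∃ f : ℂ ≃ᵢ ℂ, Set.EqOn φ ⇑f (U ∩ K)

/-- `p` is a *crease point* of the folding `φ` of the sheet `K`: near `p`, the sheet is covered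
by the two closed half-planes bounded by a line through `p`, with `φ` agreeing with two
distinct isometries on the two halves. -/
def CreasePtOn (K : Set ℂ) (φ : ℂ → ℂ) (p : ℂ) : Prop :=
  ∃ U ∈ nhds p, ∃ d : ℂ, d ≠ 0 ∧ ∃ f₁ f₂ : ℂ ≃ᵢ ℂ, f₁ ≠ f₂ ∧
    Set.EqOn φ ⇑f₁ (U ∩ K ∩ closedHalfPlane p d) ∧
    Set.EqOn φ ⇑f₂ (U ∩ K ∩ closedHalfPlane p (-d))

/-- `p` is a *vertex point* of the folding `φ` of the sheet `K`: near `p`, the sheet is covered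
by finitely many (at least three) closed wedges with apex `p`, with `φ` agreeing with an
isometry on each wedge and at least three distinct isometries occurring. -/
def VertexPtOn (K : Set ℂ) (φ : ℂ → ℂ) (p : ℂ) : Prop :=
  ∃ U ∈ nhds p, ∃ n : ℕ, 3 ≤ n ∧ ∃ (α β : Fin n → ℝ) (f : Fin n → ℂ ≃ᵢ ℂ),
    (∀ i, α i < β i) ∧ (U ∩ K) ⊆ ⋃ i, wedge p (α i) (β i) ∧
    (∀ i, Set.EqOn φ ⇑(f i) (U ∩ K ∩ wedge p (α i) (β i))) ∧
    3 ≤ (Set.range f).ncard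

/-- An *outer local flat folding* of a compact convex region `K`: every point of `K` is an
unfolded point, a crease point, or a vertex point, and all vertex points lie on the boundary
of `K`. -/
structure IsOuterLocalFlatFolding (K : Set ℂ) (φ : ℂ → ℂ) : Prop where
  compact : IsCompact K
  convex : Convex ℝ K
  interior_nonempty : (interior K).Nonempty
  continuousOn : ContinuousOn φ K
  classify : ∀ p ∈ K, UnfoldedPtOn K φ p ∨ CreasePtOn K φ p ∨ VertexPtOn K φ p
  vertex_boundary : ∀ p ∈ K, VertexPtOn K φ p → p ∈ frontier K

/-- The creases of an outer folding are chords of `K`: `u` and `v` are boundary points, the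
open segment between them passes through the interior of `K`, and consists of crease points. -/
def IsCreaseOf (K : Set ℂ) (φ : ℂ → ℂ) (u v : ℂ) : Prop :=
  u ∈ frontier K ∧ v ∈ frontier K ∧ u ≠ v ∧
  openSegment ℝ u v ⊆ interior K ∧
  ∀ z ∈ openSegment ℝ u v, CreasePtOn K φ z

/-- An *outer global flat folding*: an outer local flat folding that, for every `ε > 0`, is
`ε`-close to the vertical projection of a topological embedding of `K` into space. -/
def IsOuterGlobalFlatFolding (K : Set ℂ) (φ : ℂ → ℂ) : Prop :=
  IsOuterLocalFlatFolding K φ ∧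
  ∀ ε : ℝ, 0 < ε → ∃ ψ : ℂ → Space3,
    Topology.IsEmbedding (fun p : K => ψ ↑p) ∧ ∀ p ∈ K, dist (φ p) (proj2 (ψ p)) ≤ ε

/-- `C` is one of the two regions into which the segment `uv` divides `K`. -/
def SideRegion (K : Set ℂ) (u v : ℂ) (C : Set ℂ) : Prop :=
  C = K ∩ {z : ℂ | 0 ≤ ((z - u) * starRingEnd ℂ (v - u)).im} ∨
  C = K ∩ {z : ℂ | ((z - u) * starRingEnd ℂ (v - u)).im ≤ 0}

/-- Along the boundary curve of `C` from `u` to `v` (the part of the boundary of `K` on `C`'s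
side), distances from `u` are monotonically increasing and distances from `v` are
monotonically decreasing. -/
def MonotoneBoundaryArc (K : Set ℂ) (u v : ℂ) (C : Set ℂ) : Prop :=
  ∃ γ : ℝ → ℂ, ContinuousOn γ (Set.Icc 0 1) ∧ γ 0 = u ∧ γ 1 = v ∧
    γ '' Set.Icc 0 1 = frontier K ∩ C ∧
    MonotoneOn (fun t => dist u (γ t)) (Set.Icc 0 1) ∧
    AntitoneOn (fun t => dist v (γ t)) (Set.Icc 0 1)

/-- Reflection of the plane across the line through `u` and `v`. -/
def lineReflect (u v z : ℂ) : ℂ := u + (v - u) * starRingEnd ℂ ((z - u) / (v - u))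

/-- A crease `uv` of `φ`, splitting off the region `C` of `K` with monotone boundary arc, is
*safe* when the reflection across the line `uv` of the boundary arc of `C` does not cross any
crease of `φ`. -/
def SafeCrease (K : Set ℂ) (φ : ℂ → ℂ) (u v : ℂ) (C : Set ℂ) : Prop :=
  IsCreaseOf K φ u v ∧ SideRegion K u v C ∧ MonotoneBoundaryArc K u v C ∧
  ∀ p ∈ lineReflect u v '' (frontier K ∩ C), p ∉ segment ℝ u v → ¬ CreasePtOn K φ p

/-- The vertices of the graph of an outer folding: boundary points of `K` lying on creases. -/
def OuterVertex (K : Set ℂ) (φ : ℂ → ℂ) : Type := {p : ℂ // ∃ q : ℂ, IsCreaseOf K φ p q}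

/-- The graph of an outer folding: vertices are boundary points of `K` on creases, and edges
join the two endpoints of each crease. -/
def outerGraph (K : Set ℂ) (φ : ℂ → ℂ) : SimpleGraph (OuterVertex K φ) :=
  SimpleGraph.fromRel fun a b => IsCreaseOf K φ a.1 b.1

/-- `K` is a (closed, solid) square in the plane. -/
def IsSquareRegion (K : Set ℂ) : Prop :=
  ∃ c w : ℂ, w ≠ 0 ∧
    K = (fun z : ℂ => c + w * z) '' {z : ℂ | z.re ∈ Set.Icc 0 1 ∧ z.im ∈ Set.Icc 0 1}

/-- The functional `e` takes opposite strict signs at `p` and `q`. -/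
def Straddles (e : ℂ → ℝ) (p q : ℂ) : Prop := (e p < 0 ∧ 0 < e q) ∨ (0 < e p ∧ e q < 0)

/-- Within `Ω`, the closed positive side of `e` lies in the open positive side of `e'`. -/
def Beyond (Ω : Set ℂ) (e e' : ℂ → ℝ) : Prop := ∀ p ∈ Ω, 0 ≤ e p → 0 < e' p

/-- A height function on the positive side of `e`, vanishing on the negative side, that
separates the points of the closed positive side identified by `φ`. -/
def BranchLift (Ω : Set ℂ) (φ : ℂ → ℂ) (e : ℂ → ℝ) : Prop :=
  ∃ t : ℂ → ℝ, ContinuousOn t Ω ∧ (∀ p ∈ Ω, e p ≤ 0 → t p = 0) ∧ (∀ p ∈ Ω, 0 < e p → 0 < t p) ∧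
    ∀ p ∈ Ω, ∀ q ∈ Ω, 0 ≤ e p → 0 ≤ e q → φ p = φ q → t p = t q → p = q

lemma Beyond.trans {Ω : Set ℂ} {e₁ e₂ e₃ : ℂ → ℝ} (h : Beyond Ω e₁ e₂) (h' : Beyond Ω e₂ e₃) :
    Beyond Ω e₁ e₃ := fun p hp h1 => h' p hp (h p hp h1).le

lemma exists_outermost {Ω : Set ℂ} (E : Finset (ℂ → ℝ)) (hE : E.Nonempty)
    (tot : ∀ e ∈ E, ∀ e' ∈ E, e ≠ e' → Beyond Ω e e' ∨ Beyond Ω e' e) :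
    ∃ e₀ ∈ E, ∀ e ∈ E, e ≠ e₀ → Beyond Ω e e₀ := by
  classical
  induction hE using Finset.Nonempty.cons_induction with
  | singleton a => exact ⟨a, by simp, by simp⟩
  | cons a s ha hs ih =>
    obtain ⟨e₀, h0, h1⟩ := ih fun e he e' he' => tot e (by simp [he]) e' (by simp [he'])
    have hne : e₀ ≠ a := by rintro rfl; exact ha h0
    rcases tot e₀ (by simp [h0]) a (by simp) hne with h | h
    · refine ⟨a, by simp, fun e he hea => ?_⟩
      rcases Finset.mem_cons.1 he with rfl | he
      · exact absurd rfl hea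
      by_cases hee : e = e₀
      · exact hee ▸ h
      · exact (h1 e he hee).trans h
    · refine ⟨e₀, by simp [h0], fun e he hea => ?_⟩
      rcases Finset.mem_cons.1 he with rfl | he
      · exact h
      · exact h1 e he hea

lemma BranchLift.extend {Ω : Set ℂ} {φ : ℂ → ℂ} {z e : ℂ → ℝ} (hz : Continuous z)
    (he : Continuous e) (hb : Beyond Ω e z) (h : BranchLift Ω φ e)
    (sep : ∀ p ∈ Ω, ∀ q ∈ Ω, 0 ≤ z p → 0 ≤ z q → e p ≤ 0 → e q ≤ 0 → φ p = φ q → p = q) :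
    BranchLift Ω φ z := by
  obtain ⟨t, tc, t0, tp, ti⟩ := h
  have hpos : ∀ p ∈ Ω, 0 < max (z p) 0 + max (-e p) 0 := by
    intro p hp
    rcases lt_or_ge (e p) 0 with h | h
    · have : 0 < max (-e p) 0 := lt_max_of_lt_left (by linarith)
      have : 0 ≤ max (z p) 0 := le_max_right _ _
      linarith
    · have : 0 < max (z p) 0 := lt_max_of_lt_left (hb p hp h)
      have : 0 ≤ max (-e p) 0 := le_max_right _ _
      linarith
  have tneg : ∀ p ∈ Ω, e p < 0 → max (z p) 0 / (max (z p) 0 + max (-e p) 0) + t p < 1 := by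
    intro p hp h
    rw [t0 p hp h.le, add_zero, div_lt_one (hpos p hp)]
    have : 0 < max (-e p) 0 := lt_max_of_lt_left (by linarith)
    linarith
  have tpos : ∀ p ∈ Ω, 0 ≤ e p → max (z p) 0 / (max (z p) 0 + max (-e p) 0) + t p = 1 + t p := by
    intro p hp h
    have h2 : max (-e p) 0 = 0 := max_eq_right (by linarith)
    have := hpos p hp
    rw [h2, add_zero] at this ⊢
    rw [div_self this.ne']
  have tnn : ∀ p ∈ Ω, 0 ≤ t p := by
    intro p hp
    rcases le_or_gt (e p) 0 with h | h
    · rw [t0 p hp h]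
    · exact (tp p hp h).le
  refine ⟨fun p => max (z p) 0 / (max (z p) 0 + max (-e p) 0) + t p, ?_, ?_, ?_, ?_⟩
  · refine ContinuousOn.add (ContinuousOn.div ?_ ?_ fun p hp => (hpos p hp).ne') tc
    · fun_prop
    · fun_prop
  · intro p hp h
    have : e p < 0 := by
      by_contra! h1
      exact absurd (hb p hp h1) (not_lt.2 h)
    simp [max_eq_right h, t0 p hp this.le]
  · intro p hp h
    exact add_pos_of_pos_of_nonneg (div_pos (lt_max_of_lt_left h) (hpos p hp)) (tnn p hp)
  · intro p hp q hq hp0 hq0 hφ ht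
    simp only at ht
    rcases lt_or_ge (e p) 0 with h1 | h1 <;> rcases lt_or_ge (e q) 0 with h2 | h2
    · exact sep p hp q hq hp0 hq0 h1.le h2.le hφ
    · have := tneg p hp h1
      rw [ht, tpos q hq h2] at this
      linarith [tnn q hq]
    · have := tneg q hq h2
      rw [← ht, tpos p hp h1] at this
      linarith [tnn p hp]
    · rw [tpos p hp h1, tpos q hq h2] at ht
      exact ti p hp q hq h1 h2 hφ (by linarith)

lemma BranchLift.of_chain {Ω : Set ℂ} {φ : ℂ → ℂ} (E : Finset (ℂ → ℝ)) (z : ℂ → ℝ)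
    (hz : Continuous z) (hE : ∀ e ∈ E, Continuous e) (nested : ∀ e ∈ E, Beyond Ω e z)
    (tot : ∀ e ∈ E, ∀ e' ∈ E, e ≠ e' → Beyond Ω e e' ∨ Beyond Ω e' e)
    (sep : ∀ p ∈ Ω, ∀ q ∈ Ω, 0 ≤ z p → 0 ≤ z q → (∃ e ∈ E, e p ≤ 0 ∧ e q ≤ 0) →
      (∀ e ∈ E, ¬ Straddles e p q) → φ p = φ q → p = q)
    (term : ∀ e, (e = z ∨ e ∈ E) → (∀ e' ∈ E, e' ≠ e → Beyond Ω e e') → BranchLift Ω φ e) :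
    BranchLift Ω φ z := by
  classical
  induction hn : E.card generalizing E z with
  | zero =>
    rw [Finset.card_eq_zero] at hn
    subst hn
    exact term z (Or.inl rfl) (by simp)
  | succ n ih =>
    have hne : E.Nonempty := Finset.card_pos.1 (by omega)
    obtain ⟨e₀, h0, h1⟩ := exists_outermost E hne tot
    refine BranchLift.extend hz (hE e₀ h0) (nested e₀ h0)
      (ih (E.erase e₀) e₀ (hE e₀ h0) (fun e he => hE e (Finset.mem_of_mem_erase he))
        (fun e he => h1 e (Finset.mem_of_mem_erase he) (Finset.ne_of_mem_erase he))
        (fun e he e' he' => tot e (Finset.mem_of_mem_erase he) e' (Finset.mem_of_mem_erase he'))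
        ?_ ?_ (by rw [Finset.card_erase_of_mem h0, hn]; rfl)) ?_
    · rintro p hp q hq hp0 hq0 ⟨e, he, hepq⟩ hst hφ
      refine sep p hp q hq (nested _ h0 p hp hp0).le (nested _ h0 q hq hq0).le
        ⟨e, Finset.mem_of_mem_erase he, hepq⟩ ?_ hφ
      intro e' he'
      by_cases hee : e' = e₀
      · subst hee
        rintro (h | h) <;> linarith [h.1, h.2]
      · exact hst e' (Finset.mem_erase.2 ⟨hee, he'⟩)
    · intro e he hb
      have heE : e ∈ E := by
        rcases he with rfl | he
        · exact h0
        · exact Finset.mem_of_mem_erase he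
      refine term e (Or.inr heE) fun e' he' hne' => ?_
      by_cases hee : e' = e₀
      · subst hee
        exact h1 e heE hne'.symm
      · exact hb e' (Finset.mem_erase.2 ⟨hee, he'⟩) hne'
    · intro p hp q hq hp0 hq0 hep heq hφ
      refine sep p hp q hq hp0 hq0 ⟨e₀, h0, hep, heq⟩ ?_ hφ
      intro e he
      by_cases hee : e = e₀
      · subst hee
        rintro (h | h) <;> linarith [h.1, h.2]
      · rintro (h | h)
        · linarith [h1 e he hee q hq h.2.le]
        · linarith [h1 e he hee p hp h.1.le]

lemma BranchLift.of_corner_chain {Ω : Set ℂ} {φ : ℂ → ℂ} (E : Finset (ℂ → ℝ)) (z : ℂ → ℝ)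
    (hz : Continuous z) (hE : ∀ e ∈ E, Continuous e) (nested : ∀ e ∈ E, Beyond Ω e z)
    (tot : ∀ e ∈ E, ∀ e' ∈ E, e ≠ e' → Beyond Ω e e' ∨ Beyond Ω e' e)
    (sep : ∀ p ∈ Ω, ∀ q ∈ Ω, 0 ≤ z p → 0 ≤ z q →
      (∀ e ∈ E, ¬ Straddles e p q) → φ p = φ q → p = q) :
    BranchLift Ω φ z := by
  refine BranchLift.of_chain E z hz hE nested tot
    (fun p hp q hq h1 h2 _ h3 h4 => sep p hp q hq h1 h2 h3 h4) ?_
  intro e he hb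
  have hez : ∀ p ∈ Ω, 0 ≤ e p → 0 ≤ z p := by
    rcases he with rfl | he
    · exact fun p _ h => h
    · exact fun p hp h => (nested e he p hp h).le
  have hec : Continuous e := by
    rcases he with rfl | he
    exacts [hz, hE e he]
  refine ⟨fun p => max (e p) 0, by fun_prop, fun p hp h => max_eq_right h,
    fun p hp h => lt_max_of_lt_left h, ?_⟩
  intro p hp q hq hp0 hq0 hφ _
  refine sep p hp q hq (hez p hp hp0) (hez q hq hq0) ?_ hφ
  intro e' he'
  by_cases hee : e' = e
  · subst hee
    rintro (h | h) <;> linarith [h.1, h.2]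
  · rintro (h | h)
    · linarith [hb e' he' hee p hp hp0]
    · linarith [hb e' he' hee q hq hq0]

lemma ContinuousOn.if_nonneg {Ω : Set ℂ} {f e : ℂ → ℝ} (hf : ContinuousOn f Ω)
    (he : Continuous e) (h : ∀ p ∈ Ω, e p = 0 → f p = 0) :
    ContinuousOn (fun p => if 0 ≤ e p then f p else 0) Ω := by
  have hfr : ∀ p, p ∈ frontier {p | 0 ≤ e p} → e p = 0 := fun p hp =>
    (frontier_le_subset_eq continuous_const he hp).symm
  refine ContinuousOn.if ?_ ?_ ?_
  · rintro p ⟨hp, hp'⟩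
    exact h p hp (hfr p hp')
  · exact hf.mono inter_subset_left
  · exact continuousOn_const

/-- A face with root crease `s` and two further creases `a`, `b`, where the branch behind `a`
does not reach the crease `b`. -/
lemma BranchLift.of_star_side {Ω : Set ℂ} {φ : ℂ → ℂ} (hφ : ContinuousOn φ Ω)
    {s a b DS DB : ℂ → ℝ} (hs : Continuous s) (hb : Continuous b)
    (hDS : Continuous DS) (hDB : Continuous DB)
    (has : Beyond Ω a s) (hbs : Beyond Ω b s) (hab : ∀ p ∈ Ω, 0 ≤ a p → b p < 0)
    (lifta : BranchLift Ω φ a) (liftb : BranchLift Ω φ b)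
    (sep : ∀ p ∈ Ω, ∀ q ∈ Ω, 0 ≤ s p → 0 ≤ s q → a p ≤ 0 → a q ≤ 0 → b p ≤ 0 → b q ≤ 0 →
      φ p = φ q → p = q)
    (DS0 : ∀ y, 0 ≤ DS y) (DB0 : ∀ y, 0 ≤ DB y)
    (DSL : ∀ p ∈ Ω, 0 ≤ s p → a p ≤ 0 → b p ≤ 0 → DS (φ p) = s p)
    (DBL : ∀ p ∈ Ω, 0 ≤ s p → a p ≤ 0 → b p ≤ 0 → DB (φ p) = - b p)
    (DBA : ∀ p ∈ Ω, 0 < a p → 0 < DB (φ p)) : BranchLift Ω φ s := by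
  obtain ⟨t, tc, t0, tp, ti⟩ := lifta
  obtain ⟨r, rc, r0, rp, ri⟩ := liftb
  have tnn : ∀ p ∈ Ω, 0 ≤ t p := fun p hp =>
    (le_or_gt (a p) 0).elim (fun h => (t0 p hp h).ge) fun h => (tp p hp h).le
  have rnn : ∀ p ∈ Ω, 0 ≤ r p := fun p hp =>
    (le_or_gt (b p) 0).elim (fun h => (r0 p hp h).ge) fun h => (rp p hp h).le
  have hneg : ∀ p ∈ Ω, s p ≤ 0 → a p < 0 ∧ b p < 0 := by
    intro p hp h
    constructor <;> by_contra! h1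
    · linarith [has p hp h1]
    · linarith [hbs p hp h1]
  set B : ℂ → ℝ := fun p => if 0 ≤ b p then DB (φ p) else 0 with hB
  have hBc : ContinuousOn B Ω := by
    refine ContinuousOn.if_nonneg (hDB.comp_continuousOn hφ) hb ?_
    intro p hp h
    have hap : a p ≤ 0 := by
      by_contra! h1
      linarith [hab p hp h1.le]
    rw [DBL p hp (hbs p hp h.ge).le hap h.le, h, neg_zero]
  set T : ℂ → ℝ := fun p => DS (φ p) + t p / (1 + t p) * DB (φ p) + (B p + r p) with hT
  have hTc : ContinuousOn T Ω := by
    refine ((hDS.comp_continuousOn hφ).add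
      ((tc.div (continuousOn_const.add tc) fun p hp => ?_).mul (hDB.comp_continuousOn hφ))).add
      (hBc.add rc)
    exact (by linarith [tnn p hp] : (0 : ℝ) < 1 + t p).ne'
  have TL : ∀ p ∈ Ω, a p ≤ 0 → b p ≤ 0 → 0 ≤ s p → T p = DS (φ p) := by
    intro p hp h1 h2 h3
    have : B p = 0 := by
      by_cases h : 0 ≤ b p
      · simp only [hB, if_pos h]
        rw [DBL p hp h3 h1 h2]; linarith
      · simp [hB, h]
    simp [hT, t0 p hp h1, r0 p hp h2, this]
  have TA : ∀ p ∈ Ω, 0 < a p → T p = DS (φ p) + t p / (1 + t p) * DB (φ p) := by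
    intro p hp h1
    have h2 := hab p hp h1.le
    simp [hT, hB, not_le.2 h2, r0 p hp h2.le]
  have TB : ∀ p ∈ Ω, 0 < b p → T p = DS (φ p) + (DB (φ p) + r p) := by
    intro p hp h1
    have h2 : a p ≤ 0 := by
      by_contra! h
      linarith [hab p hp h.le]
    simp [hT, hB, h1.le, t0 p hp h2]
  have key : ∀ p ∈ Ω, 0 < a p → 0 < t p / (1 + t p) * DB (φ p) ∧
      t p / (1 + t p) * DB (φ p) < DB (φ p) := by
    intro p hp h
    have h1 := tp p hp h
    have h2 := DBA p hp h
    have h3 : t p / (1 + t p) < 1 := by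
      rw [div_lt_one (by positivity)]; linarith
    exact ⟨by positivity, by nlinarith⟩
  refine ⟨fun p => if 0 ≤ s p then T p else 0, ?_, ?_, ?_, ?_⟩
  · refine ContinuousOn.if_nonneg hTc hs ?_
    intro p hp h
    obtain ⟨h1, h2⟩ := hneg p hp h.le
    rw [TL p hp h1.le h2.le h.ge, DSL p hp h.ge h1.le h2.le, h]
  · intro p hp h
    obtain ⟨h1, h2⟩ := hneg p hp h
    by_cases h3 : 0 ≤ s p
    · simp only [if_pos h3]
      rw [TL p hp h1.le h2.le h3, DSL p hp h3 h1.le h2.le]; linarith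
    · simp [h3]
  · intro p hp h
    simp only [if_pos h.le]
    rcases lt_or_ge 0 (a p) with h1 | h1
    · rw [TA p hp h1]
      linarith [DS0 (φ p), (key p hp h1).1]
    rcases lt_or_ge 0 (b p) with h2 | h2
    · rw [TB p hp h2]
      linarith [DS0 (φ p), DB0 (φ p), rp p hp h2]
    rw [TL p hp h1 h2 h.le, DSL p hp h.le h1 h2]
    exact h
  · intro p hp q hq hsp hsq hpq hTT
    simp only [if_pos hsp, if_pos hsq] at hTT
    rcases lt_or_ge 0 (a p) with hap | hap
    · have k1 := key p hp hap
      rw [TA p hp hap] at hTT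
      rcases lt_or_ge 0 (a q) with haq | haq
      · rw [TA q hq haq, hpq] at hTT
        have hD := DBA q hq haq
        have h1 : t p / (1 + t p) = t q / (1 + t q) :=
          mul_right_cancel₀ hD.ne' (by linarith)
        have := tnn p hp
        have := tnn q hq
        rw [div_eq_div_iff (by positivity) (by positivity)] at h1
        exact ti p hp q hq hap.le haq.le hpq (by linarith)
      rcases lt_or_ge 0 (b q) with hbq | hbq
      · rw [TB q hq hbq] at hTT
        rw [hpq] at hTT k1
        linarith [rnn q hq]
      · rw [TL q hq haq hbq hsq] at hTT
        rw [hpq] at hTT k1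
        linarith
    rcases lt_or_ge 0 (b p) with hbp | hbp
    · rw [TB p hp hbp] at hTT
      rcases lt_or_ge 0 (a q) with haq | haq
      · have k1 := key q hq haq
        rw [TA q hq haq, hpq] at hTT
        linarith [rnn p hp]
      rcases lt_or_ge 0 (b q) with hbq | hbq
      · rw [TB q hq hbq, hpq] at hTT
        exact ri p hp q hq hbp.le hbq.le hpq (by linarith)
      · rw [TL q hq haq hbq hsq, hpq] at hTT
        linarith [rp p hp hbp, DB0 (φ q)]
    · rw [TL p hp hap hbp hsp] at hTT
      rcases lt_or_ge 0 (a q) with haq | haq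
      · have k1 := key q hq haq
        rw [TA q hq haq, hpq] at hTT
        linarith
      rcases lt_or_ge 0 (b q) with hbq | hbq
      · rw [TB q hq hbq, hpq] at hTT
        linarith [rp q hq hbq, DB0 (φ q)]
      · exact sep p hp q hq hsp hsq hap haq hbp hbq hpq

/-- A face with root crease `s` and two further creases `a`, `b`, where the branch behind `a`
does not reach the root crease. -/
lemma BranchLift.of_star_root {Ω : Set ℂ} {φ : ℂ → ℂ} (hφ : ContinuousOn φ Ω)
    {s a b DS : ℂ → ℝ} (hs : Continuous s) (hDS : Continuous DS)
    (has : Beyond Ω a s) (hbs : Beyond Ω b s) (hab : ∀ p ∈ Ω, 0 ≤ a p → b p < 0)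
    (lifta : BranchLift Ω φ a) (liftb : BranchLift Ω φ b)
    (sep : ∀ p ∈ Ω, ∀ q ∈ Ω, 0 ≤ s p → 0 ≤ s q → a p ≤ 0 → a q ≤ 0 → b p ≤ 0 → b q ≤ 0 →
      φ p = φ q → p = q)
    (DS0 : ∀ y, 0 ≤ DS y)
    (DSL : ∀ p ∈ Ω, 0 ≤ s p → a p ≤ 0 → b p ≤ 0 → DS (φ p) = s p)
    (DSA : ∀ p ∈ Ω, 0 < a p → 0 < DS (φ p)) : BranchLift Ω φ s := by
  obtain ⟨t, tc, t0, tp, ti⟩ := lifta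
  obtain ⟨r, rc, r0, rp, ri⟩ := liftb
  have tnn : ∀ p ∈ Ω, 0 ≤ t p := fun p hp =>
    (le_or_gt (a p) 0).elim (fun h => (t0 p hp h).ge) fun h => (tp p hp h).le
  have hneg : ∀ p ∈ Ω, s p ≤ 0 → a p < 0 ∧ b p < 0 := by
    intro p hp h
    constructor <;> by_contra! h1
    · linarith [has p hp h1]
    · linarith [hbs p hp h1]
  set T : ℂ → ℝ := fun p => DS (φ p) / (1 + t p) + r p with hT
  have hTc : ContinuousOn T Ω := by
    refine ((hDS.comp_continuousOn hφ).div (continuousOn_const.add tc) fun p hp => ?_).add rc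
    exact (by linarith [tnn p hp] : (0 : ℝ) < 1 + t p).ne'
  have TL : ∀ p ∈ Ω, a p ≤ 0 → b p ≤ 0 → T p = DS (φ p) := by
    intro p hp h1 h2
    simp [hT, t0 p hp h1, r0 p hp h2]
  have TA : ∀ p ∈ Ω, 0 < a p → T p = DS (φ p) / (1 + t p) := by
    intro p hp h1
    simp [hT, r0 p hp (hab p hp h1.le).le]
  have TB : ∀ p ∈ Ω, 0 < b p → T p = DS (φ p) + r p := by
    intro p hp h1
    have h2 : a p ≤ 0 := by
      by_contra! h
      linarith [hab p hp h.le]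
    simp [hT, t0 p hp h2]
  have key : ∀ p ∈ Ω, 0 < a p → 0 < DS (φ p) / (1 + t p) ∧ DS (φ p) / (1 + t p) < DS (φ p) := by
    intro p hp h
    have h1 := tp p hp h
    have h2 := DSA p hp h
    exact ⟨by positivity, div_lt_self h2 (by linarith)⟩
  refine ⟨fun p => if 0 ≤ s p then T p else 0, ?_, ?_, ?_, ?_⟩
  · refine ContinuousOn.if_nonneg hTc hs ?_
    intro p hp h
    obtain ⟨h1, h2⟩ := hneg p hp h.le
    rw [TL p hp h1.le h2.le, DSL p hp h.ge h1.le h2.le, h]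
  · intro p hp h
    obtain ⟨h1, h2⟩ := hneg p hp h
    by_cases h3 : 0 ≤ s p
    · simp only [if_pos h3]
      rw [TL p hp h1.le h2.le, DSL p hp h3 h1.le h2.le]; linarith
    · simp [h3]
  · intro p hp h
    simp only [if_pos h.le]
    rcases lt_or_ge 0 (a p) with h1 | h1
    · rw [TA p hp h1]
      exact (key p hp h1).1
    rcases lt_or_ge 0 (b p) with h2 | h2
    · rw [TB p hp h2]
      linarith [DS0 (φ p), rp p hp h2]
    rw [TL p hp h1 h2, DSL p hp h.le h1 h2]
    exact h
  · intro p hp q hq hsp hsq hpq hTT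
    simp only [if_pos hsp, if_pos hsq] at hTT
    rcases lt_or_ge 0 (a p) with hap | hap
    · have k1 := key p hp hap
      rw [TA p hp hap] at hTT
      rcases lt_or_ge 0 (a q) with haq | haq
      · rw [TA q hq haq, hpq] at hTT
        have hD := DSA q hq haq
        have := tnn p hp
        have := tnn q hq
        rw [div_eq_div_iff (by positivity) (by positivity)] at hTT
        have h1 := mul_left_cancel₀ hD.ne' hTT
        exact ti p hp q hq hap.le haq.le hpq (by linarith)
      rcases lt_or_ge 0 (b q) with hbq | hbq
      · rw [TB q hq hbq] at hTT
        rw [hpq] at hTT k1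
        linarith [rp q hq hbq]
      · rw [TL q hq haq hbq] at hTT
        rw [hpq] at hTT k1
        linarith
    rcases lt_or_ge 0 (b p) with hbp | hbp
    · rw [TB p hp hbp] at hTT
      rcases lt_or_ge 0 (a q) with haq | haq
      · have k1 := key q hq haq
        rw [TA q hq haq, hpq] at hTT
        linarith [rp p hp hbp]
      rcases lt_or_ge 0 (b q) with hbq | hbq
      · rw [TB q hq hbq, hpq] at hTT
        exact ri p hp q hq hbp.le hbq.le hpq (by linarith)
      · rw [TL q hq haq hbq, hpq] at hTT
        linarith [rp p hp hbp]
    · rw [TL p hp hap hbp] at hTT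
      rcases lt_or_ge 0 (a q) with haq | haq
      · have k1 := key q hq haq
        rw [TA q hq haq, hpq] at hTT
        linarith
      rcases lt_or_ge 0 (b q) with hbq | hbq
      · rw [TB q hq hbq, hpq] at hTT
        linarith [rp q hq hbq]
      · exact sep p hp q hq hsp hsq hap haq hbp hbq hpq

/-- Two branch lifts on the two sides of a line combine to a separating height function. -/
lemma exists_height_of_branchLifts {Ω : Set ℂ} {φ : ℂ → ℂ} {s : ℂ → ℝ}
    (h₁ : BranchLift Ω φ s) (h₂ : BranchLift Ω φ (fun z => - s z)) :
    ∃ h : ℂ → ℝ, ContinuousOn h Ω ∧ ∀ p ∈ Ω, ∀ q ∈ Ω, φ p = φ q → h p = h q → p = q := by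
  obtain ⟨t, tc, t0, tp, ti⟩ := h₁
  obtain ⟨r, rc, r0, rp, ri⟩ := h₂
  refine ⟨fun p => r p - t p, rc.sub tc, fun p hp q hq hpq h => ?_⟩
  simp only at h
  rcases lt_or_ge 0 (s p) with h1 | h1 <;> rcases lt_or_ge 0 (s q) with h2 | h2
  · rw [r0 p hp (by linarith), r0 q hq (by linarith)] at h
    exact ti p hp q hq h1.le h2.le hpq (by linarith)
  · rw [r0 p hp (by linarith), t0 q hq h2] at h
    have := tp p hp h1
    rcases lt_or_eq_of_le h2 with h3 | h3
    · linarith [rp q hq (by linarith)]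
    · linarith [r0 q hq (by linarith)]
  · rw [r0 q hq (by linarith), t0 p hp h1] at h
    have := tp q hq h2
    rcases lt_or_eq_of_le h1 with h3 | h3
    · linarith [rp p hp (by linarith)]
    · linarith [r0 p hp (by linarith)]
  · rw [t0 p hp h1, t0 q hq h2] at h
    exact ri p hp q hq (by linarith) (by linarith) hpq (by linarith)

lemma lens_abscissa_pos {a a' x y X Y : ℝ} (ha : 0 < a) (ha' : 0 < a') (hx : 0 < x) (hy : 0 < y)
    (hT : 0 ≤ a * a' - a * x - a' * y)
    (h₁ : X ^ 2 + (Y - a) ^ 2 ≤ x ^ 2 + (y - a) ^ 2)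
    (h₂ : (X - a') ^ 2 + Y ^ 2 ≤ (x - a') ^ 2 + y ^ 2) : 0 < X := by
  by_contra! hX
  have e1 : Y ^ 2 - 2 * a * Y ≤ x ^ 2 + y ^ 2 - 2 * a * y := by nlinarith [sq_nonneg X]
  have e2 : Y ^ 2 ≤ x ^ 2 + y ^ 2 - 2 * a' * x := by nlinarith [sq_nonneg X]
  have hxa : x < a' := by nlinarith [mul_pos ha' hy]
  have hya : y < a := by nlinarith [mul_pos ha hx]
  obtain ⟨d, rfl⟩ : ∃ d, Y = y - d := ⟨y - Y, by ring⟩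
  have f1 : d * (2 * (a - y) + d) ≤ x ^ 2 := by nlinarith
  have f2 : 2 * a' * x - x ^ 2 ≤ d * (2 * y - d) := by nlinarith
  have hd : 0 < d := by
    by_contra! hd
    nlinarith [mul_pos hx (sub_pos.2 hxa), mul_pos hx ha']
  have f3 : a * x ≤ a' * (a - y) := by nlinarith
  have f4 : d * (2 * (a * x) + a' * d) ≤ a' * x ^ 2 := by
    nlinarith [mul_le_mul_of_nonneg_left f3 hd.le]
  have f5 : 2 * a * d < a' * x := by
    by_contra! h
    nlinarith [mul_pos ha' (mul_pos hd hd), mul_le_mul_of_nonneg_right h hx.le]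
  nlinarith [mul_pos hx (sub_pos.2 hxa), mul_pos hd (sub_pos.2 hya), sq_nonneg d, mul_pos hx ha']

/-- Points no farther from the ends of the hypotenuse than a point of a right triangle lie in the
kite formed by the triangle and its mirror image. -/
lemma lens_affine_pos {a a' x y X Y : ℝ} (ha : 0 < a) (ha' : 0 < a') (hx : 0 < x) (hy : 0 < y)
    (hT : 0 ≤ a * a' - a * x - a' * y)
    (h₁ : X ^ 2 + (Y - a) ^ 2 ≤ x ^ 2 + (y - a) ^ 2)
    (h₂ : (X - a') ^ 2 + Y ^ 2 ≤ (x - a') ^ 2 + y ^ 2)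
    {l₀ l₁ l₂ : ℝ} (hc : 0 ≤ l₀) (hu : 0 ≤ l₀ + l₂ * a) (hv : 0 ≤ l₀ + l₁ * a')
    (huv : 0 < l₀ + l₂ * a ∨ 0 < l₀ + l₁ * a')
    (hc' : 0 ≤ l₀ * (a ^ 2 + a' ^ 2) + l₁ * (2 * a' * a ^ 2) + l₂ * (2 * a * a' ^ 2)) :
    0 < l₀ + l₁ * X + l₂ * Y := by
  have tri : ∀ {X Y : ℝ}, X ^ 2 + (Y - a) ^ 2 ≤ x ^ 2 + (y - a) ^ 2 →
      (X - a') ^ 2 + Y ^ 2 ≤ (x - a') ^ 2 + y ^ 2 → 0 < X ∧ 0 < Y := fun {X Y} h1 h2 =>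
    ⟨lens_abscissa_pos ha ha' hx hy hT h1 h2,
      lens_abscissa_pos (X := Y) (Y := X) ha' ha hy hx (by linarith) (by linarith) (by linarith)⟩
  have comb : ∀ {α β γ A B C : ℝ}, 0 < α → 0 < β → 0 ≤ γ → 0 ≤ A → 0 ≤ B → (0 < A ∨ 0 < B) →
      0 ≤ C → 0 < α * A + β * B + γ * C := by
    intro α β γ A B C h1 h2 h3 h4 h5 h6 h7
    rcases h6 with h6 | h6
    · have := mul_pos h1 h6; positivity
    · have := mul_pos h2 h6; positivity
  rcases le_or_gt 0 (a * a' - a * X - a' * Y) with h | h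
  · obtain ⟨hX, hY⟩ := tri h₁ h₂
    have := comb (mul_pos ha' hY) (mul_pos ha hX) h hu hv huv hc
    have e : a' * Y * (l₀ + l₂ * a) + a * X * (l₀ + l₁ * a') + (a * a' - a * X - a' * Y) * l₀
        = a * a' * (l₀ + l₁ * X + l₂ * Y) := by ring
    rw [e] at this
    exact pos_of_mul_pos_right this (by positivity)
  · have hn : 0 < a ^ 2 + a' ^ 2 := by positivity
    set k := 2 * (a * a' - a * X - a' * Y) / (a ^ 2 + a' ^ 2) with hk
    have hkn : k * (a ^ 2 + a' ^ 2) = 2 * (a * a' - a * X - a' * Y) := by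
      rw [hk]; field_simp
    have i1 : (X + k * a) ^ 2 + (Y + k * a' - a) ^ 2 = X ^ 2 + (Y - a) ^ 2 := by
      linear_combination k * hkn
    have i2 : (X + k * a - a') ^ 2 + (Y + k * a') ^ 2 = (X - a') ^ 2 + Y ^ 2 := by
      linear_combination k * hkn
    obtain ⟨hX, hY⟩ := tri (X := X + k * a) (Y := Y + k * a') (by linarith) (by linarith)
    have hg : 0 ≤ -(a * a' - a * X - a' * Y) := by linarith
    have := comb (mul_pos (mul_pos ha' hY) hn) (mul_pos (mul_pos ha hX) hn) hg hu hv huv hc'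
    have e : a' * (Y + k * a') * (a ^ 2 + a' ^ 2) * (l₀ + l₂ * a)
        + a * (X + k * a) * (a ^ 2 + a' ^ 2) * (l₀ + l₁ * a')
        + -(a * a' - a * X - a' * Y) *
          (l₀ * (a ^ 2 + a' ^ 2) + l₁ * (2 * a' * a ^ 2) + l₂ * (2 * a * a' ^ 2))
        = a * a' * (a ^ 2 + a' ^ 2) * (l₀ + l₁ * X + l₂ * Y) := by
      linear_combination (a' * a' * (l₀ + l₂ * a) + a * a * (l₀ + l₁ * a')) * hkn
    rw [e] at this
    exact pos_of_mul_pos_right this (by positivity)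

/-- The open unit square. -/
def openSq : Set ℂ := {z | 0 < z.re ∧ z.re < 1 ∧ 0 < z.im ∧ z.im < 1}

/-- A real functional that respects affine combinations of two points. -/
def RespectsAffine (e : ℂ → ℝ) : Prop :=
  ∀ (p q : ℂ) (α β : ℝ), α + β = 1 → e (α • p + β • q) = α * e p + β * e q

/-- Positive on the corner cut off at `i` by the chord from `(1 - p.1) i` to `p.2 + i`. -/
def tlFun (p : ℝ × ℝ) (z : ℂ) : ℝ := p.1 * p.2 - p.1 * z.re - p.2 * (1 - z.im)

/-- Positive on the corner cut off at `0` by the chord from `p.1 i` to `p.2`. -/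
def blFun (p : ℝ × ℝ) (z : ℂ) : ℝ := p.1 * p.2 - p.1 * z.re - p.2 * z.im

/-- Positive to the left of the chord from `p.1` to `p.2 + i`. -/
def spanFun (p : ℝ × ℝ) (z : ℂ) : ℝ := p.1 + (p.2 - p.1) * z.im - z.re

@[fun_prop] lemma continuous_tlFun (p : ℝ × ℝ) : Continuous (tlFun p) := by
  unfold tlFun; fun_prop

@[fun_prop] lemma continuous_blFun (p : ℝ × ℝ) : Continuous (blFun p) := by
  unfold blFun; fun_prop

@[fun_prop] lemma continuous_spanFun (p : ℝ × ℝ) : Continuous (spanFun p) := by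
  unfold spanFun; fun_prop

lemma respectsAffine_tlFun (p : ℝ × ℝ) : RespectsAffine (tlFun p) := by
  intro z w α β h
  obtain rfl : β = 1 - α := by linarith
  simp [tlFun]; ring

lemma respectsAffine_blFun (p : ℝ × ℝ) : RespectsAffine (blFun p) := by
  intro z w α β h
  obtain rfl : β = 1 - α := by linarith
  simp [blFun]; ring

lemma respectsAffine_spanFun (p : ℝ × ℝ) : RespectsAffine (spanFun p) := by
  intro z w α β h
  obtain rfl : β = 1 - α := by linarith
  simp [spanFun]; ring

lemma isOpen_openSq : IsOpen openSq := by
  have : openSq = {z : ℂ | 0 < z.re} ∩ ({z | z.re < 1} ∩ ({z | 0 < z.im} ∩ {z | z.im < 1})) := rfl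
  rw [this]
  exact (isOpen_lt (by fun_prop) (by fun_prop)).inter ((isOpen_lt (by fun_prop) (by fun_prop)).inter
    ((isOpen_lt (by fun_prop) (by fun_prop)).inter (isOpen_lt (by fun_prop) (by fun_prop))))

lemma convex_openSq : Convex ℝ openSq := by
  rintro p ⟨h1, h2, h3, h4⟩ q ⟨k1, k2, k3, k4⟩ α β hα hβ h
  simp only [openSq, mem_ofPred_eq, Complex.add_re, Complex.smul_re, Complex.add_im, Complex.smul_im,
    smul_eq_mul]
  rcases hα.eq_or_lt with rfl | hα
  · obtain rfl : β = 1 := by linarith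
    simp [*]
  obtain rfl : α = 1 - β := by linarith
  refine ⟨?_, ?_, ?_, ?_⟩ <;> nlinarith

lemma beyond_tlFun {p q : ℝ × ℝ} (h1 : 0 < p.1) (h2 : 0 < p.2) (h : p ≤ q) (hne : p ≠ q) :
    Beyond openSq (tlFun p) (tlFun q) := by
  obtain ⟨a, a'⟩ := p
  obtain ⟨b, b'⟩ := q
  rintro z ⟨hz1, hz2, hz3, hz4⟩ hz
  obtain ⟨hab, hab'⟩ : a ≤ b ∧ a' ≤ b' := h
  simp only [tlFun] at *
  have hne' : a < b ∨ a' < b' := by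
    by_contra! hc
    exact hne (Prod.ext (le_antisymm hab hc.1) (le_antisymm hab' hc.2))
  have hY : 0 < 1 - z.im := by linarith
  set Y := 1 - z.im
  have e1 : 0 ≤ b' * b * (a' * a - a * z.re - a' * Y) :=
    mul_nonneg (mul_nonneg (by linarith) (by linarith)) (by linarith)
  have hbp : 0 < b := by linarith
  have hbp' : 0 < b' := by linarith
  have e2 : 0 < a * b * z.re * (b' - a') + a' * b' * Y * (b - a) := by
    rcases hne' with hh | hh
    · have : 0 < a' * b' * Y * (b - a) := mul_pos (by positivity) (by linarith)
      have : 0 ≤ a * b * z.re * (b' - a') := mul_nonneg (by positivity) (by linarith)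
      linarith
    · have : 0 ≤ a' * b' * Y * (b - a) := mul_nonneg (by positivity) (by linarith)
      have : 0 < a * b * z.re * (b' - a') := mul_pos (by positivity) (by linarith)
      linarith
  have e3 : 0 < (a * a') * (b * b' - b * z.re - b' * Y) := by linarith
  exact pos_of_mul_pos_right e3 (by positivity)

lemma beyond_blFun {p q : ℝ × ℝ} (h1 : 0 < p.1) (h2 : 0 < p.2) (h : p ≤ q) (hne : p ≠ q) :
    Beyond openSq (blFun p) (blFun q) := by
  intro z hz h0
  have := beyond_tlFun h1 h2 h hne ⟨z.re, 1 - z.im⟩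
    ⟨hz.1, hz.2.1, by simpa using hz.2.2.2, by simpa using hz.2.2.1⟩
  simp only [tlFun, blFun] at *
  simpa using this (by simpa using h0)

lemma beyond_tlFun_spanFun {p σ : ℝ × ℝ} (h1 : 0 < p.1) (h1' : p.1 ≤ 1) (h2 : 0 < p.2)
    (hs : 0 ≤ σ.1) (h : p.2 ≤ σ.2) (hne : ¬ (p.1 = 1 ∧ σ.1 = 0 ∧ p.2 = σ.2)) :
    Beyond openSq (tlFun p) (spanFun σ) := by
  obtain ⟨a, a'⟩ := p
  obtain ⟨s, t⟩ := σ
  rintro z ⟨hz1, hz2, hz3, hz4⟩ hz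
  simp only [tlFun, spanFun] at *
  have e1 : 0 ≤ a * (s * (1 - z.im) + (t - a') * z.im) + a' * ((1 - a) * (1 - z.im)) + 0 := by
    have : 0 ≤ (t - a') * z.im := mul_nonneg (by linarith) hz3.le
    have : 0 ≤ (1 - a) * (1 - z.im) := mul_nonneg (by linarith) (by linarith)
    have : 0 ≤ s * (1 - z.im) := mul_nonneg hs (by linarith)
    positivity
  have e2 : 0 < a * (s * (1 - z.im) + (t - a') * z.im) + a' * ((1 - a) * (1 - z.im)) := by
    refine lt_of_le_of_ne (by linarith) fun h0 => hne ?_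
    have k1 : 0 ≤ (t - a') * z.im := mul_nonneg (by linarith) hz3.le
    have k2 : 0 ≤ (1 - a) * (1 - z.im) := mul_nonneg (by linarith) (by linarith)
    have k3 : 0 ≤ s * (1 - z.im) := mul_nonneg hs (by linarith)
    have k4 : a * (s * (1 - z.im) + (t - a') * z.im) = 0 := by
      have := mul_nonneg h1.le (add_nonneg k3 k1)
      have := mul_nonneg h2.le k2
      linarith
    have k5 : a' * ((1 - a) * (1 - z.im)) = 0 := by linarith
    have k6 : s * (1 - z.im) + (t - a') * z.im = 0 := by
      simpa [h1.ne'] using k4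
    have k7 : (1 - a) = 0 := by
      have : 1 - z.im ≠ 0 := by linarith
      simpa [h2.ne', this] using k5
    have k8 : s = 0 := by
      have : 1 - z.im ≠ 0 := by linarith
      simpa [this] using (by linarith : s * (1 - z.im) = 0)
    have k9 : t - a' = 0 := by
      simpa [hz3.ne'] using (by linarith : (t - a') * z.im = 0)
    exact ⟨by linarith, k8, by linarith⟩
  have e3 : 0 < a * (s + (t - s) * z.im - z.re) := by linarith
  exact pos_of_mul_pos_right e3 h1.le

lemma beyond_blFun_spanFun {p σ : ℝ × ℝ} (h1 : 0 < p.1) (h1' : p.1 ≤ 1) (h2 : 0 < p.2)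
    (hs : 0 ≤ σ.2) (h : p.2 ≤ σ.1) (hne : ¬ (p.1 = 1 ∧ σ.2 = 0 ∧ p.2 = σ.1)) :
    Beyond openSq (blFun p) (spanFun σ) := by
  intro z hz h0
  have := beyond_tlFun_spanFun (σ := σ.swap) h1 h1' h2 hs h hne ⟨z.re, 1 - z.im⟩
    ⟨hz.1, hz.2.1, by simpa using hz.2.2.2, by simpa using hz.2.2.1⟩
  simp only [tlFun, blFun, spanFun, Prod.fst_swap, Prod.snd_swap] at *
  have := this (by simpa using h0)
  linarith

lemma blFun_neg_of_tlFun_nonneg {p q : ℝ × ℝ} (h1 : 0 < p.1) (h2 : 0 < p.2) (h3 : 0 < q.1)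
    (h4 : 0 < q.2) (h : p.1 + q.1 ≤ 1) : ∀ z ∈ openSq, 0 ≤ tlFun p z → blFun q z < 0 := by
  obtain ⟨a, a'⟩ := p
  obtain ⟨b, b'⟩ := q
  rintro z ⟨hz1, hz2, hz3, hz4⟩ hz
  simp only [tlFun, blFun] at *
  have : 0 < a' * (a - (1 - z.im)) := by nlinarith [mul_pos h1 hz1]
  have := pos_of_mul_pos_right this h2.le
  nlinarith [mul_pos h3 hz1]

lemma tlFun_neg_of_blFun_nonneg {p q : ℝ × ℝ} (h1 : 0 < p.1) (h2 : 0 < p.2) (h3 : 0 < q.1)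
    (h4 : 0 < q.2) (h : p.1 + q.1 ≤ 1) : ∀ z ∈ openSq, 0 ≤ blFun q z → tlFun p z < 0 := by
  intro z hz h0
  by_contra! h5
  linarith [blFun_neg_of_tlFun_nonneg h1 h2 h3 h4 h z hz h5]

lemma dist_le_iff_sq (w q u : ℂ) : dist w u ≤ dist q u ↔
    (w.re - u.re) ^ 2 + (w.im - u.im) ^ 2 ≤ (q.re - u.re) ^ 2 + (q.im - u.im) ^ 2 := by
  rw [Complex.dist_eq_re_im, Complex.dist_eq_re_im]
  exact Real.sqrt_le_sqrt_iff (by positivity)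

lemma tlFun_lens {p : ℝ × ℝ} {q w : ℂ} (h1 : 0 < p.1) (h2 : 0 < p.2) (hq : q ∈ openSq)
    (h : 0 ≤ tlFun p q) (hu : dist w ⟨0, 1 - p.1⟩ ≤ dist q ⟨0, 1 - p.1⟩)
    (hv : dist w ⟨p.2, 1⟩ ≤ dist q ⟨p.2, 1⟩) {l₀ l₁ l₂ : ℝ} (c0 : 0 ≤ l₀) (c1 : 0 ≤ l₀ + l₂ * p.1)
    (c2 : 0 ≤ l₀ + l₁ * p.2) (c3 : 0 < l₀ + l₂ * p.1 ∨ 0 < l₀ + l₁ * p.2)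
    (c4 : 0 ≤ l₀ * (p.1 ^ 2 + p.2 ^ 2) + l₁ * (2 * p.2 * p.1 ^ 2) + l₂ * (2 * p.1 * p.2 ^ 2)) :
    0 < l₀ + l₁ * w.re + l₂ * (1 - w.im) := by
  rw [dist_le_iff_sq] at hu hv
  simp only at hu hv
  refine lens_affine_pos h1 h2 hq.1 (by linarith [hq.2.2.2] : 0 < 1 - q.im) h ?_ ?_ c0 c1 c2 c3 c4
  · linarith
  · linarith

lemma blFun_lens {p : ℝ × ℝ} {q w : ℂ} (h1 : 0 < p.1) (h2 : 0 < p.2) (hq : q ∈ openSq)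
    (h : 0 ≤ blFun p q) (hu : dist w ⟨0, p.1⟩ ≤ dist q ⟨0, p.1⟩)
    (hv : dist w ⟨p.2, 0⟩ ≤ dist q ⟨p.2, 0⟩) {l₀ l₁ l₂ : ℝ} (c0 : 0 ≤ l₀) (c1 : 0 ≤ l₀ + l₂ * p.1)
    (c2 : 0 ≤ l₀ + l₁ * p.2) (c3 : 0 < l₀ + l₂ * p.1 ∨ 0 < l₀ + l₁ * p.2)
    (c4 : 0 ≤ l₀ * (p.1 ^ 2 + p.2 ^ 2) + l₁ * (2 * p.2 * p.1 ^ 2) + l₂ * (2 * p.1 * p.2 ^ 2)) :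
    0 < l₀ + l₁ * w.re + l₂ * w.im := by
  rw [dist_le_iff_sq] at hu hv
  simp only at hu hv
  refine lens_affine_pos h1 h2 hq.1 hq.2.2.1 h ?_ ?_ c0 c1 c2 c3 c4
  · linarith
  · linarith

/-- If two functions agree on an open face then they agree on its relative closure. -/
lemma eqOn_closedFace {Ω : Set ℂ} (hΩ : Convex ℝ Ω) {φ f : ℂ → ℂ} (hφ : ContinuousOn φ Ω)
    (hf : Continuous f) {s a b : ℂ → ℝ} (hs : RespectsAffine s) (ha : RespectsAffine a)
    (hb : RespectsAffine b) {p₀ : ℂ} (hp₀ : p₀ ∈ Ω) (s₀ : 0 < s p₀) (a₀ : a p₀ < 0) (b₀ : b p₀ < 0)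
    (h : ∀ z ∈ Ω, 0 < s z → a z < 0 → b z < 0 → φ z = f z) :
    ∀ z ∈ Ω, 0 ≤ s z → a z ≤ 0 → b z ≤ 0 → φ z = f z := by
  intro z hz hsz haz hbz
  let γ : ℝ → ℂ := fun l => (1 - l) • z + l • p₀
  have hγ : Continuous γ := by fun_prop
  have hγ0 : γ 0 = z := by simp [γ]
  have hγΩ : ∀ l ∈ Ioo (0 : ℝ) 1, γ l ∈ Ω := fun l hl =>
    hΩ hz hp₀ (by linarith [hl.2]) hl.1.le (by ring)
  have heq : ∀ l ∈ Ioo (0 : ℝ) 1, φ (γ l) = f (γ l) := by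
    intro l hl
    obtain ⟨hl0, hl1⟩ := hl
    refine h _ (hγΩ l ⟨hl0, hl1⟩) ?_ ?_ ?_
    · rw [hs _ _ _ _ (by ring)]; nlinarith
    · rw [ha _ _ _ _ (by ring)]; nlinarith
    · rw [hb _ _ _ _ (by ring)]; nlinarith
  have t0 : Filter.Tendsto γ (nhdsWithin 0 (Ioo 0 1)) (nhdsWithin z Ω) := by
    refine tendsto_nhdsWithin_iff.2 ⟨?_, Filter.eventually_of_mem self_mem_nhdsWithin hγΩ⟩
    have := (hγ.tendsto 0).mono_left (nhdsWithin_le_nhds (s := Ioo (0 : ℝ) 1))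
    rwa [hγ0] at this
  have t1 := (hφ z hz).tendsto.comp t0
  have t2 := (hf.tendsto z).comp (t0.mono_right nhdsWithin_le_nhds)
  have : (nhdsWithin (0 : ℝ) (Ioo 0 1)).NeBot :=
    mem_closure_iff_nhdsWithin_neBot.1 (by rw [closure_Ioo (by norm_num)]; simp)
  refine tendsto_nhds_unique t1 (t2.congr' ?_)
  exact Filter.eventually_of_mem self_mem_nhdsWithin fun l hl => (heq l hl).symm

lemma dist_symm_le_of_mem_closure {Ω L : Set ℂ} {φ : ℂ → ℂ} {f : ℂ ≃ᵢ ℂ}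
    (lip : ∀ p ∈ Ω, ∀ q ∈ Ω, dist (φ p) (φ q) ≤ dist p q) (hL : L ⊆ Ω)
    (hf : ∀ z ∈ L, φ z = f z) {q : ℂ} (hq : q ∈ Ω) {u : ℂ} (hu : u ∈ closure L) :
    dist (f.symm (φ q)) u ≤ dist q u := by
  refine closure_minimal (t := {u | dist (f.symm (φ q)) u ≤ dist q u}) (fun z hz => ?_)
    (isClosed_le (by fun_prop) (by fun_prop)) hu
  have : dist (f.symm (φ q)) z = dist (φ q) (φ z) := by
    rw [hf z hz, ← f.dist_eq, f.apply_symm_apply]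
  rw [mem_ofPred_eq, this]
  exact lip q hq z (hL hz)

lemma tlFun_ends_mem_closure {p : ℝ × ℝ} (h1 : 0 < p.1) (h1' : p.1 ≤ 1) (h2 : 0 < p.2)
    (h2' : p.2 ≤ 1) :
    (⟨0, 1 - p.1⟩ : ℂ) ∈ closure {z | z ∈ openSq ∧ tlFun p z = 0} ∧
      (⟨p.2, 1⟩ : ℂ) ∈ closure {z | z ∈ openSq ∧ tlFun p z = 0} := by
  have hsub : openSegment ℝ (⟨0, 1 - p.1⟩ : ℂ) ⟨p.2, 1⟩ ⊆ {z | z ∈ openSq ∧ tlFun p z = 0} := by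
    rintro z ⟨α, β, hα, hβ, h, rfl⟩
    obtain rfl : α = 1 - β := by linarith
    refine ⟨⟨?_, ?_, ?_, ?_⟩, ?_⟩ <;> simp [tlFun] <;> nlinarith
  have := closure_mono hsub
  rw [closure_openSegment] at this
  exact ⟨this (left_mem_segment _ _ _), this (right_mem_segment _ _ _)⟩

lemma blFun_ends_mem_closure {p : ℝ × ℝ} (h1 : 0 < p.1) (h1' : p.1 ≤ 1) (h2 : 0 < p.2)
    (h2' : p.2 ≤ 1) :
    (⟨0, p.1⟩ : ℂ) ∈ closure {z | z ∈ openSq ∧ blFun p z = 0} ∧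
      (⟨p.2, 0⟩ : ℂ) ∈ closure {z | z ∈ openSq ∧ blFun p z = 0} := by
  have hsub : openSegment ℝ (⟨0, p.1⟩ : ℂ) ⟨p.2, 0⟩ ⊆ {z | z ∈ openSq ∧ blFun p z = 0} := by
    rintro z ⟨α, β, hα, hβ, h, rfl⟩
    obtain rfl : α = 1 - β := by linarith
    refine ⟨⟨?_, ?_, ?_, ?_⟩, ?_⟩ <;> simp [blFun] <;> nlinarith
  have := closure_mono hsub
  rw [closure_openSegment] at this
  exact ⟨this (left_mem_segment _ _ _), this (right_mem_segment _ _ _)⟩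

/-- Lifting a face at an end of the square bounded by a spanning crease and two corner creases. -/
lemma BranchLift.of_corner_pair {φ : ℂ → ℂ} {a b σ : ℝ × ℝ} {f : ℂ ≃ᵢ ℂ}
    (a1 : 0 < a.1) (a1' : a.1 ≤ 1) (a2 : 0 < a.2) (a2' : a.2 ≤ 1)
    (b1 : 0 < b.1) (b1' : b.1 ≤ 1) (b2 : 0 < b.2) (b2' : b.2 ≤ 1)
    (hab : a.1 + b.1 ≤ 1) (haσ : a.2 ≤ σ.2) (hbσ : b.2 ≤ σ.1)
    (lip : ∀ p ∈ openSq, ∀ q ∈ openSq, dist (φ p) (φ q) ≤ dist p q)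
    (hf : ∀ z ∈ openSq, 0 ≤ spanFun σ z → tlFun a z ≤ 0 → blFun b z ≤ 0 → φ z = f z)
    (lifta : BranchLift openSq φ (tlFun a)) (liftb : BranchLift openSq φ (blFun b))
    (sep : ∀ p ∈ openSq, ∀ q ∈ openSq, 0 ≤ spanFun σ p → 0 ≤ spanFun σ q → tlFun a p ≤ 0 →
      tlFun a q ≤ 0 → blFun b p ≤ 0 → blFun b q ≤ 0 → φ p = φ q → p = q) :
    BranchLift openSq φ (spanFun σ) := by
  have hφ : ContinuousOn φ openSq :=
    (LipschitzOnWith.of_dist_le_mul (K := 1) (by simpa using lip)).continuousOn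
  have has : Beyond openSq (tlFun a) (spanFun σ) :=
    beyond_tlFun_spanFun a1 a1' a2 (by linarith) haσ (by rintro ⟨-, h, -⟩; linarith)
  have hbs : Beyond openSq (blFun b) (spanFun σ) :=
    beyond_blFun_spanFun b1 b1' b2 (by linarith) hbσ (by rintro ⟨-, h, -⟩; linarith)
  have nab := blFun_neg_of_tlFun_nonneg a1 a2 b1 b2 hab
  have nba := tlFun_neg_of_blFun_nonneg a1 a2 b1 b2 hab
  have lensA : ∀ q ∈ openSq, dist (f.symm (φ q)) ⟨0, 1 - a.1⟩ ≤ dist q ⟨0, 1 - a.1⟩ ∧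
      dist (f.symm (φ q)) ⟨a.2, 1⟩ ≤ dist q ⟨a.2, 1⟩ := by
    intro q hq
    obtain ⟨h1, h2⟩ := tlFun_ends_mem_closure a1 a1' a2 a2'
    have hf' : ∀ z ∈ {z | z ∈ openSq ∧ tlFun a z = 0}, φ z = f z := fun z hz =>
      hf z hz.1 (has z hz.1 hz.2.ge).le hz.2.le (nab z hz.1 hz.2.ge).le
    exact ⟨dist_symm_le_of_mem_closure lip (fun z hz => hz.1) hf' hq h1,
      dist_symm_le_of_mem_closure lip (fun z hz => hz.1) hf' hq h2⟩
  have lensB : ∀ q ∈ openSq, dist (f.symm (φ q)) ⟨0, b.1⟩ ≤ dist q ⟨0, b.1⟩ ∧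
      dist (f.symm (φ q)) ⟨b.2, 0⟩ ≤ dist q ⟨b.2, 0⟩ := by
    intro q hq
    obtain ⟨h1, h2⟩ := blFun_ends_mem_closure b1 b1' b2 b2'
    have hf' : ∀ z ∈ {z | z ∈ openSq ∧ blFun b z = 0}, φ z = f z := fun z hz =>
      hf z hz.1 (hbs z hz.1 hz.2.ge).le (nba z hz.1 hz.2.ge).le hz.2.le
    exact ⟨dist_symm_le_of_mem_closure lip (fun z hz => hz.1) hf' hq h1,
      dist_symm_le_of_mem_closure lip (fun z hz => hz.1) hf' hq h2⟩
  have hfs : ∀ z ∈ openSq, 0 ≤ spanFun σ z → tlFun a z ≤ 0 → blFun b z ≤ 0 →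
      f.symm (φ z) = z := fun z hz h1 h2 h3 => by
    rw [hf z hz h1 h2 h3, f.symm_apply_apply]
  have hfc : Continuous f.symm := f.symm.continuous
  have DS := fun y => le_max_left 0 (spanFun σ (f.symm y))
  have DSc : Continuous fun y => max 0 (spanFun σ (f.symm y)) := by fun_prop
  have DSL : ∀ p ∈ openSq, 0 ≤ spanFun σ p → tlFun a p ≤ 0 → blFun b p ≤ 0 →
      max 0 (spanFun σ (f.symm (φ p))) = spanFun σ p := fun p hp h1 h2 h3 => by
    rw [hfs p hp h1 h2 h3, max_eq_right h1]
  rcases le_or_gt a.2 a.1 with h | ha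
  · refine BranchLift.of_star_side hφ (by fun_prop) (by fun_prop) DSc
      (DB := fun y => max 0 (-blFun b (f.symm y))) (by fun_prop) has hbs nab lifta liftb sep DS
      (fun y => le_max_left _ _) DSL ?_ ?_
    · intro p hp h1 h2 h3
      simp only [hfs p hp h1 h2 h3]
      exact max_eq_right (by linarith)
    · intro q hq h1
      refine lt_max_of_lt_right ?_
      have := tlFun_lens a1 a2 hq h1.le (lensA q hq).1 (lensA q hq).2 (l₀ := b.2 * (1 - b.1))
        (l₁ := b.1) (l₂ := -b.2) (by nlinarith) (by nlinarith) (by nlinarith)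
        (Or.inr (by nlinarith [mul_pos b1 a2])) ?_
      · unfold blFun; linarith
      · have e1 : 0 ≤ b.2 * (1 - b.1 - a.1) * (a.1 ^ 2 + a.2 ^ 2) := by
          have : 0 ≤ 1 - b.1 - a.1 := by linarith
          positivity
        have e2 : 0 ≤ b.2 * a.1 * (a.1 - a.2) * (a.1 + a.2) := by
          have : 0 ≤ a.1 - a.2 := by linarith
          positivity
        have e3 : 0 ≤ b.1 * (2 * a.2 * a.1 ^ 2) := by positivity
        linarith
  rcases le_or_gt b.2 b.1 with h | hb
  · refine BranchLift.of_star_side hφ (by fun_prop) (by fun_prop) DSc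
      (DB := fun y => max 0 (-tlFun a (f.symm y))) (by fun_prop) hbs has nba liftb lifta
      (fun p hp q hq h1 h2 h3 h4 h5 h6 => sep p hp q hq h1 h2 h5 h6 h3 h4) DS
      (fun y => le_max_left _ _) (fun p hp h1 h2 h3 => DSL p hp h1 h3 h2) ?_ ?_
    · intro p hp h1 h2 h3
      simp only [hfs p hp h1 h3 h2]
      exact max_eq_right (by linarith)
    · intro q hq h1
      refine lt_max_of_lt_right ?_
      have := blFun_lens b1 b2 hq h1.le (lensB q hq).1 (lensB q hq).2 (l₀ := a.2 * (1 - a.1))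
        (l₁ := a.1) (l₂ := -a.2) (by nlinarith) (by nlinarith) (by nlinarith)
        (Or.inr (by nlinarith [mul_pos a1 b2])) ?_
      · unfold tlFun; linarith
      · have e1 : 0 ≤ a.2 * (1 - a.1 - b.1) * (b.1 ^ 2 + b.2 ^ 2) := by
          have : 0 ≤ 1 - a.1 - b.1 := by linarith
          positivity
        have e2 : 0 ≤ a.2 * b.1 * (b.1 - b.2) * (b.1 + b.2) := by
          have : 0 ≤ b.1 - b.2 := by linarith
          positivity
        have e3 : 0 ≤ a.1 * (2 * b.2 * b.1 ^ 2) := by positivity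
        linarith
  rcases le_total σ.2 σ.1 with h | h
  · refine BranchLift.of_star_root hφ (by fun_prop) DSc has hbs nab lifta liftb sep DS DSL ?_
    intro q hq h1
    refine lt_max_of_lt_right ?_
    have := tlFun_lens a1 a2 hq h1.le (lensA q hq).1 (lensA q hq).2 (l₀ := σ.2)
        (l₁ := -1) (l₂ := σ.1 - σ.2) (by linarith) (by nlinarith) (by nlinarith)
        (Or.inl (by nlinarith)) ?_
    · unfold spanFun; linarith
    · have e1 : 0 ≤ (σ.2 - a.2) * (a.1 ^ 2 + a.2 ^ 2) := mul_nonneg (by linarith) (by positivity)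
      have e2 : 0 ≤ a.2 * (a.2 - a.1) * (a.1 + a.2) := by
        have : 0 ≤ a.2 - a.1 := by linarith
        positivity
      have e3 : 0 ≤ (σ.1 - σ.2) * (2 * a.1 * a.2 ^ 2) := mul_nonneg (by linarith) (by positivity)
      linarith
  · refine BranchLift.of_star_root hφ (by fun_prop) DSc hbs has nba liftb lifta
      (fun p hp q hq h1 h2 h3 h4 h5 h6 => sep p hp q hq h1 h2 h5 h6 h3 h4) DS
      (fun p hp h1 h2 h3 => DSL p hp h1 h3 h2) ?_
    intro q hq h1
    refine lt_max_of_lt_right ?_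
    have := blFun_lens b1 b2 hq h1.le (lensB q hq).1 (lensB q hq).2 (l₀ := σ.1)
        (l₁ := -1) (l₂ := σ.2 - σ.1) (by linarith) (by nlinarith) (by nlinarith)
        (Or.inl (by nlinarith)) ?_
    · unfold spanFun; linarith
    · have e1 : 0 ≤ (σ.1 - b.2) * (b.1 ^ 2 + b.2 ^ 2) := mul_nonneg (by linarith) (by positivity)
      have e2 : 0 ≤ b.2 * (b.2 - b.1) * (b.1 + b.2) := by
        have : 0 ≤ b.2 - b.1 := by linarith
        positivity
      have e3 : 0 ≤ (σ.2 - σ.1) * (2 * b.1 * b.2 ^ 2) := mul_nonneg (by linarith) (by positivity)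
      linarith

lemma RespectsAffine.convex_pos {e : ℂ → ℝ} (he : RespectsAffine e) : Convex ℝ {z | 0 < e z} := by
  rintro p hp q hq α β hα hβ h
  rw [mem_ofPred_eq] at *
  rw [he p q α β h]
  rcases hα.eq_or_lt with rfl | hα
  · obtain rfl : β = 1 := by linarith
    simpa using hq
  · have := mul_pos hα hp
    have := mul_nonneg hβ hq.le
    linarith

lemma RespectsAffine.neg {e : ℂ → ℝ} (he : RespectsAffine e) : RespectsAffine fun z => -e z := by
  intro p q α β h
  simp only [he p q α β h]
  ring

lemma RespectsAffine.convex_neg {e : ℂ → ℝ} (he : RespectsAffine e) : Convex ℝ {z | e z < 0} := by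
  simpa using he.neg.convex_pos

lemma tot_image_tlFun [DecidableEq (ℂ → ℝ)] {A : Finset (ℝ × ℝ)} (hA : ∀ e ∈ A, 0 < e.1 ∧ 0 < e.2)
    (cA : ∀ e ∈ A, ∀ e' ∈ A, e ≤ e' ∨ e' ≤ e) :
    ∀ e ∈ A.image tlFun, ∀ e' ∈ A.image tlFun, e ≠ e' → Beyond openSq e e' ∨ Beyond openSq e' e := by
  intro e he e' he' hne
  obtain ⟨p, hp, rfl⟩ := Finset.mem_image.1 he
  obtain ⟨q, hq, rfl⟩ := Finset.mem_image.1 he'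
  have hpq : p ≠ q := by rintro rfl; exact hne rfl
  exact (cA p hp q hq).imp (fun h => beyond_tlFun (hA p hp).1 (hA p hp).2 h hpq)
    fun h => beyond_tlFun (hA q hq).1 (hA q hq).2 h hpq.symm

lemma tot_image_blFun [DecidableEq (ℂ → ℝ)] {A : Finset (ℝ × ℝ)} (hA : ∀ e ∈ A, 0 < e.1 ∧ 0 < e.2)
    (cA : ∀ e ∈ A, ∀ e' ∈ A, e ≤ e' ∨ e' ≤ e) :
    ∀ e ∈ A.image blFun, ∀ e' ∈ A.image blFun, e ≠ e' → Beyond openSq e e' ∨ Beyond openSq e' e := by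
  intro e he e' he' hne
  obtain ⟨p, hp, rfl⟩ := Finset.mem_image.1 he
  obtain ⟨q, hq, rfl⟩ := Finset.mem_image.1 he'
  have hpq : p ≠ q := by rintro rfl; exact hne rfl
  exact (cA p hp q hq).imp (fun h => beyond_blFun (hA p hp).1 (hA p hp).2 h hpq)
    fun h => beyond_blFun (hA q hq).1 (hA q hq).2 h hpq.symm

/-- Lifting the part of a folded square that lies to the left of all its spanning creases. -/
lemma BranchLift.of_corners {φ : ℂ → ℂ} {A B : Finset (ℝ × ℝ)} {σ : ℝ × ℝ}
    (σ1 : 0 ≤ σ.1) (σ2 : 0 ≤ σ.2)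
    (hA : ∀ e ∈ A, 0 < e.1 ∧ e.1 ≤ 1 ∧ 0 < e.2 ∧ e.2 ≤ 1)
    (hB : ∀ e ∈ B, 0 < e.1 ∧ e.1 ≤ 1 ∧ 0 < e.2 ∧ e.2 ≤ 1)
    (cA : ∀ e ∈ A, ∀ e' ∈ A, e ≤ e' ∨ e' ≤ e) (cB : ∀ e ∈ B, ∀ e' ∈ B, e ≤ e' ∨ e' ≤ e)
    (hAB : ∀ a ∈ A, ∀ b ∈ B, a.1 + b.1 ≤ 1)
    (hAσ : ∀ a ∈ A, a.2 ≤ σ.2) (hBσ : ∀ b ∈ B, b.2 ≤ σ.1)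
    (nA : ∀ a ∈ A, ¬ (a.1 = 1 ∧ σ.1 = 0 ∧ a.2 = σ.2))
    (nB : ∀ b ∈ B, ¬ (b.1 = 1 ∧ σ.2 = 0 ∧ b.2 = σ.1))
    (lip : ∀ p ∈ openSq, ∀ q ∈ openSq, dist (φ p) (φ q) ≤ dist p q)
    (iso : ∀ p ∈ openSq, ∀ q ∈ openSq, 0 ≤ spanFun σ p → 0 ≤ spanFun σ q →
      (∀ e ∈ A, ¬ Straddles (tlFun e) p q) → (∀ e ∈ B, ¬ Straddles (blFun e) p q) →
      φ p = φ q → p = q)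
    (frame : ∀ G : Set ℂ, IsOpen G → Convex ℝ G → G ⊆ openSq → (∀ z ∈ G, 0 < spanFun σ z) →
      (∀ e ∈ A, ∀ z ∈ G, tlFun e z ≠ 0) → (∀ e ∈ B, ∀ z ∈ G, blFun e z ≠ 0) →
      ∃ f : ℂ ≃ᵢ ℂ, EqOn φ f G) :
    BranchLift openSq φ (spanFun σ) := by
  classical
  have sA : ∀ a ∈ A, Beyond openSq (tlFun a) (spanFun σ) := fun a ha =>
    beyond_tlFun_spanFun (hA a ha).1 (hA a ha).2.1 (hA a ha).2.2.1 σ1 (hAσ a ha) (nA a ha)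
  have sB : ∀ b ∈ B, Beyond openSq (blFun b) (spanFun σ) := fun b hb =>
    beyond_blFun_spanFun (hB b hb).1 (hB b hb).2.1 (hB b hb).2.2.1 σ2 (hBσ b hb) (nB b hb)
  have tA := tot_image_tlFun (fun e he => ⟨(hA e he).1, (hA e he).2.2.1⟩) cA
  have tB := tot_image_blFun (fun e he => ⟨(hB e he).1, (hB e he).2.2.1⟩) cB
  have conA : ∀ e ∈ A.image tlFun, Continuous e := by
    intro e he
    obtain ⟨p, hp, rfl⟩ := Finset.mem_image.1 he
    fun_prop
  have conB : ∀ e ∈ B.image blFun, Continuous e := by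
    intro e he
    obtain ⟨p, hp, rfl⟩ := Finset.mem_image.1 he
    fun_prop
  rcases B.eq_empty_or_nonempty with rfl | hBne
  · refine BranchLift.of_corner_chain (A.image tlFun) _ (by fun_prop) conA ?_ tA ?_
    · intro e he
      obtain ⟨p, hp, rfl⟩ := Finset.mem_image.1 he
      exact sA p hp
    · intro p hp q hq h1 h2 h3 h4
      exact iso p hp q hq h1 h2 (fun e he => h3 _ (Finset.mem_image_of_mem _ he)) (by simp) h4
  rcases A.eq_empty_or_nonempty with rfl | hAne
  · refine BranchLift.of_corner_chain (B.image blFun) _ (by fun_prop) conB ?_ tB ?_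
    · intro e he
      obtain ⟨p, hp, rfl⟩ := Finset.mem_image.1 he
      exact sB p hp
    · intro p hp q hq h1 h2 h3 h4
      exact iso p hp q hq h1 h2 (by simp) (fun e he => h3 _ (Finset.mem_image_of_mem _ he)) h4
  obtain ⟨ea, hea, oA⟩ := exists_outermost _ (hAne.image tlFun) tA
  obtain ⟨eb, heb, oB⟩ := exists_outermost _ (hBne.image blFun) tB
  obtain ⟨a, ha, rfl⟩ := Finset.mem_image.1 hea
  obtain ⟨b, hb, rfl⟩ := Finset.mem_image.1 heb
  obtain ⟨a1, a1', a2, a2'⟩ := hA a ha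
  obtain ⟨b1, b1', b2, b2'⟩ := hB b hb
  have hab := hAB a ha b hb
  have nab : ∀ e ∈ B, ∀ z ∈ openSq, 0 ≤ tlFun a z → blFun e z < 0 := fun e he =>
    blFun_neg_of_tlFun_nonneg a1 a2 (hB e he).1 (hB e he).2.2.1 (hAB a ha e he)
  have nba : ∀ e ∈ A, ∀ z ∈ openSq, 0 ≤ blFun b z → tlFun e z < 0 := fun e he =>
    tlFun_neg_of_blFun_nonneg (hA e he).1 (hA e he).2.2.1 b1 b2 (hAB e he b hb)
  have lifta : BranchLift openSq φ (tlFun a) := by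
    refine BranchLift.of_corner_chain ((A.image tlFun).erase (tlFun a)) _ (by fun_prop)
      (fun e he => conA e (Finset.mem_of_mem_erase he))
      (fun e he => oA e (Finset.mem_of_mem_erase he) (Finset.ne_of_mem_erase he))
      (fun e he e' he' => tA e (Finset.mem_of_mem_erase he) e' (Finset.mem_of_mem_erase he')) ?_
    intro p hp q hq hp0 hq0 hst hpq
    refine iso p hp q hq (sA a ha p hp hp0).le (sA a ha q hq hq0).le ?_ ?_ hpq
    · intro e he
      by_cases hee : tlFun e = tlFun a
      · rw [hee]
        rintro (h | h) <;> linarith [h.1, h.2]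
      · exact hst _ (Finset.mem_erase.2 ⟨hee, Finset.mem_image_of_mem _ he⟩)
    · intro e he
      have := nab e he p hp hp0
      have := nab e he q hq hq0
      rintro (h | h) <;> linarith [h.1, h.2]
  have liftb : BranchLift openSq φ (blFun b) := by
    refine BranchLift.of_corner_chain ((B.image blFun).erase (blFun b)) _ (by fun_prop)
      (fun e he => conB e (Finset.mem_of_mem_erase he))
      (fun e he => oB e (Finset.mem_of_mem_erase he) (Finset.ne_of_mem_erase he))
      (fun e he e' he' => tB e (Finset.mem_of_mem_erase he) e' (Finset.mem_of_mem_erase he')) ?_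
    intro p hp q hq hp0 hq0 hst hpq
    refine iso p hp q hq (sB b hb p hp hp0).le (sB b hb q hq hq0).le ?_ ?_ hpq
    · intro e he
      have := nba e he p hp hp0
      have := nba e he q hq hq0
      rintro (h | h) <;> linarith [h.1, h.2]
    · intro e he
      by_cases hee : blFun e = blFun b
      · rw [hee]
        rintro (h | h) <;> linarith [h.1, h.2]
      · exact hst _ (Finset.mem_erase.2 ⟨hee, Finset.mem_image_of_mem _ he⟩)
  have posA : ∀ e ∈ A, ∀ z ∈ openSq, tlFun a z ≤ 0 → tlFun e z ≤ 0 := by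
    intro e he z hz h
    by_cases hee : tlFun e = tlFun a
    · rwa [hee]
    · by_contra! h0
      linarith [oA _ (Finset.mem_image_of_mem _ he) hee z hz h0.le]
  have posB : ∀ e ∈ B, ∀ z ∈ openSq, blFun b z ≤ 0 → blFun e z ≤ 0 := by
    intro e he z hz h
    by_cases hee : blFun e = blFun b
    · rwa [hee]
    · by_contra! h0
      linarith [oB _ (Finset.mem_image_of_mem _ he) hee z hz h0.le]
  let G : Set ℂ := openSq ∩ ({z | 0 < spanFun σ z} ∩ ({z | tlFun a z < 0} ∩ {z | blFun b z < 0}))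
  obtain ⟨f, hf⟩ : ∃ f : ℂ ≃ᵢ ℂ, EqOn φ f G := by
    refine frame G ?_ ?_ inter_subset_left (fun z hz => hz.2.1) ?_ ?_
    · exact isOpen_openSq.inter ((isOpen_lt (by fun_prop) (by fun_prop)).inter
        ((isOpen_lt (by fun_prop) (by fun_prop)).inter (isOpen_lt (by fun_prop) (by fun_prop))))
    · exact convex_openSq.inter ((respectsAffine_spanFun σ).convex_pos.inter
        ((respectsAffine_tlFun a).convex_neg.inter (respectsAffine_blFun b).convex_neg))
    · intro e he z hz h0
      by_cases hee : tlFun e = tlFun a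
      · exact absurd h0 (hee ▸ hz.2.2.1.ne)
      · exact absurd (oA _ (Finset.mem_image_of_mem _ he) hee z hz.1 h0.ge) (not_lt.2 hz.2.2.1.le)
    · intro e he z hz h0
      by_cases hee : blFun e = blFun b
      · exact absurd h0 (hee ▸ hz.2.2.2.ne)
      · exact absurd (oB _ (Finset.mem_image_of_mem _ he) hee z hz.1 h0.ge) (not_lt.2 hz.2.2.2.le)
  have hφ : ContinuousOn φ openSq :=
    (LipschitzOnWith.of_dist_le_mul (K := 1) (by simpa using lip)).continuousOn
  obtain ⟨mA, hmA, zA⟩ : ∃ m ∈ openSq, tlFun a m = 0 :=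
    ⟨⟨a.2 / 2, 1 - a.1 / 2⟩, ⟨by simp; linarith, by simp; linarith, by simp; linarith,
      by simp; linarith⟩, by simp only [tlFun]; ring⟩
  obtain ⟨mB, hmB, zB⟩ : ∃ m ∈ openSq, blFun b m = 0 :=
    ⟨⟨b.2 / 2, b.1 / 2⟩, ⟨by simp; linarith, by simp; linarith, by simp; linarith,
      by simp; linarith⟩, by simp only [blFun]; ring⟩
  have hhalf : (1 / 2 : ℝ) + 1 / 2 = 1 := by norm_num
  have hfL := eqOn_closedFace convex_openSq hφ f.continuous (respectsAffine_spanFun σ)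
    (respectsAffine_tlFun a) (respectsAffine_blFun b)
    (convex_openSq hmA hmB (by norm_num) (by norm_num) hhalf)
    (by
      rw [respectsAffine_spanFun _ _ _ _ _ hhalf]
      linarith [sA a ha mA hmA zA.ge, sB b hb mB hmB zB.ge])
    (by
      rw [respectsAffine_tlFun _ _ _ _ _ hhalf]
      linarith [nba a ha mB hmB zB.ge])
    (by
      rw [respectsAffine_blFun _ _ _ _ _ hhalf]
      linarith [nab b hb mA hmA zA.ge])
    (fun z hz h1 h2 h3 => hf ⟨hz, h1, h2, h3⟩)
  refine BranchLift.of_corner_pair a1 a1' a2 a2' b1 b1' b2 b2' hab (hAσ a ha) (hBσ b hb) lip hfL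
    lifta liftb ?_
  intro p hp q hq hp0 hq0 pa qa pb qb hpq
  refine iso p hp q hq hp0 hq0 ?_ ?_ hpq
  · intro e he
    have := posA e he p hp pa
    have := posA e he q hq qa
    rintro (h | h) <;> linarith [h.1, h.2]
  · intro e he
    have := posB e he p hp pb
    have := posB e he q hq qb
    rintro (h | h) <;> linarith [h.1, h.2]

lemma straddles_iff_of_eq_mul {e e' : ℂ → ℝ} {p q p' q' : ℂ} {c : ℝ} (hc : c ≠ 0)
    (hp : e p' = c * e' p) (hq : e q' = c * e' q) : Straddles e p' q' ↔ Straddles e' p q := by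
  unfold Straddles
  rw [hp, hq]
  rcases hc.lt_or_gt with h | h
  · simp only [mul_neg_iff, mul_pos_iff]
    grind
  · simp only [mul_neg_iff, mul_pos_iff]
    grind

/-- The map `φ` is a folding of `Ω` whose creases lie on the zero sets of the functionals `E`. -/
structure FoldedAlong (Ω : Set ℂ) (φ : ℂ → ℂ) (E : Set (ℂ → ℝ)) : Prop where
  lip : ∀ p ∈ Ω, ∀ q ∈ Ω, dist (φ p) (φ q) ≤ dist p q
  iso : ∀ p ∈ Ω, ∀ q ∈ Ω, (∀ e ∈ E, ¬ Straddles e p q) → dist (φ p) (φ q) = dist p q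
  frame : ∀ G : Set ℂ, IsOpen G → Convex ℝ G → G ⊆ Ω → (∀ e ∈ E, ∀ z ∈ G, e z ≠ 0) →
    ∃ f : ℂ ≃ᵢ ℂ, EqOn φ f G

lemma FoldedAlong.mono {Ω : Set ℂ} {φ : ℂ → ℂ} {E E' : Set (ℂ → ℝ)} (h : FoldedAlong Ω φ E)
    (hE : E ⊆ E') : FoldedAlong Ω φ E' where
  lip := h.lip
  iso p hp q hq hpq := h.iso p hp q hq fun e he => hpq e (hE he)
  frame G h1 h2 h3 h4 := h.frame G h1 h2 h3 fun e he => h4 e (hE he)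

lemma FoldedAlong.eq_of_eq {Ω : Set ℂ} {φ : ℂ → ℂ} {E : Set (ℂ → ℝ)} (h : FoldedAlong Ω φ E)
    {p q : ℂ} (hp : p ∈ Ω) (hq : q ∈ Ω) (hpq : ∀ e ∈ E, ¬ Straddles e p q) (he : φ p = φ q) :
    p = q := by
  rw [← dist_eq_zero, ← h.iso p hp q hq hpq, he, dist_self]

/-- Precomposing a folding with an isometry of its domain. -/
lemma FoldedAlong.comp {Ω : Set ℂ} {φ : ℂ → ℂ} {E E' : Set (ℂ → ℝ)} (h : FoldedAlong Ω φ E)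
    (m : ℂ ≃ᵢ ℂ) (hm : ∀ z ∈ Ω, m z ∈ Ω) (hmc : ∀ G : Set ℂ, Convex ℝ G → Convex ℝ (m '' G))
    (hE : ∀ e ∈ E, ∃ e' ∈ E', ∃ c : ℝ, c ≠ 0 ∧ ∀ z, e (m z) = c * e' z) :
    FoldedAlong Ω (fun z => φ (m z)) E' where
  lip p hp q hq := (h.lip _ (hm p hp) _ (hm q hq)).trans_eq (m.dist_eq p q)
  iso p hp q hq hpq := by
    refine (h.iso _ (hm p hp) _ (hm q hq) fun e he => ?_).trans (m.dist_eq p q)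
    obtain ⟨e', he', c, hc, hcz⟩ := hE e he
    exact (straddles_iff_of_eq_mul hc (hcz p) (hcz q)).not.2 (hpq e' he')
  frame G h1 h2 h3 h4 := by
    obtain ⟨f, hf⟩ := h.frame (m '' G) (m.toHomeomorph.isOpenMap G h1) (hmc G h2)
      (by rintro _ ⟨z, hz, rfl⟩; exact hm z (h3 hz))
      (by
        rintro e he _ ⟨z, hz, rfl⟩
        obtain ⟨e', he', c, hc, hcz⟩ := hE e he
        rw [hcz]
        exact mul_ne_zero hc (h4 _ he' z hz))
    exact ⟨m.trans f, fun z hz => hf (mem_image_of_mem m hz)⟩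

/-- The left-right reflection of the unit square. -/
def mirror : ℂ ≃ᵢ ℂ where
  toFun z := 1 - starRingEnd ℂ z
  invFun z := 1 - starRingEnd ℂ z
  left_inv z := by simp
  right_inv z := by simp
  isometry_toFun := Isometry.of_dist_eq fun z w => by
    rw [dist_sub_left, Complex.dist_conj_conj]

lemma mirror_apply (z : ℂ) : mirror z = ⟨1 - z.re, z.im⟩ := by
  apply Complex.ext <;> simp [mirror]

lemma mirror_mirror (z : ℂ) : mirror (mirror z) = z := mirror.left_inv z

lemma mirror_mem_openSq {z : ℂ} (hz : z ∈ openSq) : mirror z ∈ openSq := by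
  obtain ⟨h1, h2, h3, h4⟩ := hz
  rw [mirror_apply]
  exact ⟨by simpa using h2, by simpa using h1, h3, h4⟩

lemma convex_image_mirror {G : Set ℂ} (hG : Convex ℝ G) : Convex ℝ (mirror '' G) := by
  rintro _ ⟨p, hp, rfl⟩ _ ⟨q, hq, rfl⟩ α β hα hβ h
  refine ⟨α • p + β • q, hG hp hq hα hβ h, ?_⟩
  obtain rfl : β = 1 - α := by linarith
  apply Complex.ext <;> simp [mirror_apply]
  ring

/-- Positive on the corner cut off at `1 + i` by the chord from `1 + (1 - p.1) i` to
`1 - p.2 + i`. -/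
def trFun (p : ℝ × ℝ) (z : ℂ) : ℝ := tlFun p (mirror z)

/-- Positive on the corner cut off at `1` by the chord from `1 + p.1 i` to `1 - p.2`. -/
def brFun (p : ℝ × ℝ) (z : ℂ) : ℝ := blFun p (mirror z)

lemma spanFun_mirror (v : ℝ × ℝ) (z : ℂ) : spanFun (1 - v) (mirror z) = -spanFun v z := by
  simp [spanFun, mirror_apply]
  ring

lemma spanFun_injective : Function.Injective spanFun := by
  intro p q h
  have h0 := congrFun h 0
  have h1 := congrFun h Complex.I
  simp [spanFun] at h0 h1
  exact Prod.ext h0 h1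

lemma beyond_spanFun {p q : ℝ × ℝ} (h : p ≤ q) (hne : p ≠ q) :
    Beyond openSq (spanFun p) (spanFun q) := by
  rintro z ⟨-, -, h3, h4⟩ hz
  have h1 := h.1
  have h2 := h.2
  have h5 : p.1 < q.1 ∨ p.2 < q.2 := by
    by_contra! hc
    exact hne (Prod.ext (le_antisymm h1 hc.1) (le_antisymm h2 hc.2))
  unfold spanFun at *
  rcases h5 with h5 | h5 <;> nlinarith

lemma tlFun_le_of_spanFun {e v : ℝ × ℝ} (h1 : 0 < e.1) (h1' : e.1 ≤ 1) (h2 : 0 < e.2)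
    (hv : 0 ≤ v.1) (h : e.2 ≤ v.2) {z : ℂ} (hz : z ∈ openSq) :
    tlFun e z ≤ e.1 * spanFun v z := by
  obtain ⟨-, -, h3, h4⟩ := hz
  have k1 : 0 ≤ e.1 * ((v.2 - e.2) * z.im) :=
    mul_nonneg h1.le (mul_nonneg (by linarith) h3.le)
  have k2 : 0 ≤ e.2 * ((1 - e.1) * (1 - z.im)) :=
    mul_nonneg h2.le (mul_nonneg (by linarith) (by linarith))
  have k3 : 0 ≤ e.1 * (v.1 * (1 - z.im)) := mul_nonneg h1.le (mul_nonneg hv (by linarith))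
  unfold tlFun spanFun
  linarith

lemma blFun_le_of_spanFun {e v : ℝ × ℝ} (h1 : 0 < e.1) (h1' : e.1 ≤ 1) (h2 : 0 < e.2)
    (hv : 0 ≤ v.2) (h : e.2 ≤ v.1) {z : ℂ} (hz : z ∈ openSq) :
    blFun e z ≤ e.1 * spanFun v z := by
  obtain ⟨-, -, h3, h4⟩ := hz
  have k1 : 0 ≤ e.1 * ((v.1 - e.2) * (1 - z.im)) :=
    mul_nonneg h1.le (mul_nonneg (by linarith) (by linarith))
  have k2 : 0 ≤ e.2 * ((1 - e.1) * z.im) := mul_nonneg h2.le (mul_nonneg (by linarith) h3.le)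
  have k3 : 0 ≤ e.1 * (v.2 * z.im) := mul_nonneg h1.le (mul_nonneg hv h3.le)
  unfold blFun spanFun
  linarith

/-- Chords of the unit square, none of which joins the left side to the right side: those cutting
off the four corners, and those joining the bottom side to the top side. -/
structure ChordSystem where
  (TL BL TR BR V : Finset (ℝ × ℝ))

namespace ChordSystem

/-- The functionals vanishing along the chords. -/
def lines (C : ChordSystem) : Set (ℂ → ℝ) :=
  tlFun '' C.TL ∪ blFun '' C.BL ∪ (trFun '' C.TR ∪ brFun '' C.BR) ∪ spanFun '' C.V

/-- The chords do not cross. -/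
structure Planar (C : ChordSystem) : Prop where
  tl : ∀ e ∈ C.TL, 0 < e.1 ∧ e.1 ≤ 1 ∧ 0 < e.2 ∧ e.2 ≤ 1
  bl : ∀ e ∈ C.BL, 0 < e.1 ∧ e.1 ≤ 1 ∧ 0 < e.2 ∧ e.2 ≤ 1
  tr : ∀ e ∈ C.TR, 0 < e.1 ∧ e.1 ≤ 1 ∧ 0 < e.2 ∧ e.2 ≤ 1
  br : ∀ e ∈ C.BR, 0 < e.1 ∧ e.1 ≤ 1 ∧ 0 < e.2 ∧ e.2 ≤ 1
  span : ∀ v ∈ C.V, 0 ≤ v.1 ∧ v.1 ≤ 1 ∧ 0 ≤ v.2 ∧ v.2 ≤ 1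
  tl_chain : ∀ e ∈ C.TL, ∀ e' ∈ C.TL, e ≤ e' ∨ e' ≤ e
  bl_chain : ∀ e ∈ C.BL, ∀ e' ∈ C.BL, e ≤ e' ∨ e' ≤ e
  tr_chain : ∀ e ∈ C.TR, ∀ e' ∈ C.TR, e ≤ e' ∨ e' ≤ e
  br_chain : ∀ e ∈ C.BR, ∀ e' ∈ C.BR, e ≤ e' ∨ e' ≤ e
  span_chain : ∀ v ∈ C.V, ∀ v' ∈ C.V, v ≤ v' ∨ v' ≤ v
  tl_bl : ∀ e ∈ C.TL, ∀ e' ∈ C.BL, e.1 + e'.1 ≤ 1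
  tr_br : ∀ e ∈ C.TR, ∀ e' ∈ C.BR, e.1 + e'.1 ≤ 1
  tl_span : ∀ e ∈ C.TL, ∀ v ∈ C.V, e.2 ≤ v.2
  bl_span : ∀ e ∈ C.BL, ∀ v ∈ C.V, e.2 ≤ v.1
  tr_span : ∀ e ∈ C.TR, ∀ v ∈ C.V, e.2 ≤ 1 - v.2
  br_span : ∀ e ∈ C.BR, ∀ v ∈ C.V, e.2 ≤ 1 - v.1

/-- The mirror image of a system of chords. -/
def reflect (C : ChordSystem) : ChordSystem where
  TL := C.TR
  BL := C.BR
  TR := C.TL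
  BR := C.BL
  V := C.V.image fun v => 1 - v

variable {C : ChordSystem}

lemma Planar.reflect (h : C.Planar) : C.reflect.Planar where
  tl := h.tr
  bl := h.br
  tr := h.tl
  br := h.bl
  span := by
    intro v hv
    obtain ⟨w, hw, rfl⟩ := Finset.mem_image.1 hv
    have := h.span w hw
    simp; tauto
  tl_chain := h.tr_chain
  bl_chain := h.br_chain
  tr_chain := h.tl_chain
  br_chain := h.bl_chain
  span_chain := by
    intro v hv v' hv'
    obtain ⟨w, hw, rfl⟩ := Finset.mem_image.1 hv
    obtain ⟨w', hw', rfl⟩ := Finset.mem_image.1 hv'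
    exact (h.span_chain w hw w' hw').symm.imp (fun h => sub_le_sub_left h 1)
      fun h => sub_le_sub_left h 1
  tl_bl := h.tr_br
  tr_br := h.tl_bl
  tl_span := by
    intro e he v hv
    obtain ⟨w, hw, rfl⟩ := Finset.mem_image.1 hv
    simpa using h.tr_span e he w hw
  bl_span := by
    intro e he v hv
    obtain ⟨w, hw, rfl⟩ := Finset.mem_image.1 hv
    simpa using h.br_span e he w hw
  tr_span := by
    intro e he v hv
    obtain ⟨w, hw, rfl⟩ := Finset.mem_image.1 hv
    simpa using h.tl_span e he w hw
  br_span := by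
    intro e he v hv
    obtain ⟨w, hw, rfl⟩ := Finset.mem_image.1 hv
    simpa using h.bl_span e he w hw

lemma Planar.tlFun_le (h : C.Planar) {e v : ℝ × ℝ} (he : e ∈ C.TL) (hv : v ∈ C.V) {z : ℂ}
    (hz : z ∈ openSq) : tlFun e z ≤ e.1 * spanFun v z :=
  tlFun_le_of_spanFun (h.tl e he).1 (h.tl e he).2.1 (h.tl e he).2.2.1 (h.span v hv).1
    (h.tl_span e he v hv) hz

lemma Planar.blFun_le (h : C.Planar) {e v : ℝ × ℝ} (he : e ∈ C.BL) (hv : v ∈ C.V) {z : ℂ}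
    (hz : z ∈ openSq) : blFun e z ≤ e.1 * spanFun v z :=
  blFun_le_of_spanFun (h.bl e he).1 (h.bl e he).2.1 (h.bl e he).2.2.1 (h.span v hv).2.2.1
    (h.bl_span e he v hv) hz

lemma Planar.trFun_le (h : C.Planar) {e v : ℝ × ℝ} (he : e ∈ C.TR) (hv : v ∈ C.V) {z : ℂ}
    (hz : z ∈ openSq) : trFun e z ≤ -(e.1 * spanFun v z) := by
  have := h.reflect.tlFun_le (e := e) (v := 1 - v) he (Finset.mem_image_of_mem _ hv)
    (mirror_mem_openSq hz)
  rw [spanFun_mirror] at this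
  unfold trFun
  linarith

lemma Planar.brFun_le (h : C.Planar) {e v : ℝ × ℝ} (he : e ∈ C.BR) (hv : v ∈ C.V) {z : ℂ}
    (hz : z ∈ openSq) : brFun e z ≤ -(e.1 * spanFun v z) := by
  have := h.reflect.blFun_le (e := e) (v := 1 - v) he (Finset.mem_image_of_mem _ hv)
    (mirror_mem_openSq hz)
  rw [spanFun_mirror] at this
  unfold brFun
  linarith

lemma forall_lines {P : (ℂ → ℝ) → Prop} (h1 : ∀ e ∈ C.TL, P (tlFun e)) (h2 : ∀ e ∈ C.BL, P (blFun e))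
    (h3 : ∀ e ∈ C.TR, P (trFun e)) (h4 : ∀ e ∈ C.BR, P (brFun e))
    (h5 : ∀ e ∈ C.V, P (spanFun e)) : ∀ e ∈ C.lines, P e := by
  rintro _ (((⟨e, he, rfl⟩ | ⟨e, he, rfl⟩) | (⟨e, he, rfl⟩ | ⟨e, he, rfl⟩)) | ⟨e, he, rfl⟩)
  exacts [h1 e he, h2 e he, h3 e he, h4 e he, h5 e he]

lemma branchLift_left (h : C.Planar) {φ : ℂ → ℂ} (hφ : FoldedAlong openSq φ C.lines) {v : ℝ × ℝ}
    (hv : v ∈ C.V) (hmin : ∀ w ∈ C.V, w ≠ v → Beyond openSq (spanFun v) (spanFun w)) :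
    BranchLift openSq φ (spanFun v) := by
  classical
  have tlc : ∀ e ∈ C.TL, (e.1 = 1 ∧ v.1 = 0 ∧ e.2 = v.2) → tlFun e = spanFun v := by
    rintro e he ⟨h1, h2, h3⟩
    funext z
    simp only [tlFun, spanFun, h1, h2, h3]
    ring
  have blc : ∀ e ∈ C.BL, (e.1 = 1 ∧ v.2 = 0 ∧ e.2 = v.1) → blFun e = spanFun v := by
    rintro e he ⟨h1, h2, h3⟩
    funext z
    simp only [blFun, spanFun, h1, h2, h3]
    ring
  refine BranchLift.of_corners (A := C.TL.filter fun e => ¬ (e.1 = 1 ∧ v.1 = 0 ∧ e.2 = v.2))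
    (B := C.BL.filter fun e => ¬ (e.1 = 1 ∧ v.2 = 0 ∧ e.2 = v.1)) (h.span v hv).1
    (h.span v hv).2.2.1 (fun e he => h.tl e (Finset.mem_filter.1 he).1)
    (fun e he => h.bl e (Finset.mem_filter.1 he).1)
    (fun e he e' he' => h.tl_chain e (Finset.mem_filter.1 he).1 e' (Finset.mem_filter.1 he').1)
    (fun e he e' he' => h.bl_chain e (Finset.mem_filter.1 he).1 e' (Finset.mem_filter.1 he').1)
    (fun e he e' he' => h.tl_bl e (Finset.mem_filter.1 he).1 e' (Finset.mem_filter.1 he').1)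
    (fun e he => h.tl_span e (Finset.mem_filter.1 he).1 v hv)
    (fun e he => h.bl_span e (Finset.mem_filter.1 he).1 v hv)
    (fun e he => (Finset.mem_filter.1 he).2) (fun e he => (Finset.mem_filter.1 he).2)
    hφ.lip ?_ ?_
  · intro p hp q hq p0 q0 hA hB
    refine hφ.eq_of_eq hp hq (forall_lines ?_ ?_ ?_ ?_ ?_)
    · intro e he
      by_cases hc : e.1 = 1 ∧ v.1 = 0 ∧ e.2 = v.2
      · rw [tlc e he hc]
        rintro (h | h) <;> linarith [h.1, h.2]
      · exact hA e (Finset.mem_filter.2 ⟨he, hc⟩)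
    · intro e he
      by_cases hc : e.1 = 1 ∧ v.2 = 0 ∧ e.2 = v.1
      · rw [blc e he hc]
        rintro (h | h) <;> linarith [h.1, h.2]
      · exact hB e (Finset.mem_filter.2 ⟨he, hc⟩)
    · intro e he
      have e1 := h.trFun_le he hv hp
      have e2 := h.trFun_le he hv hq
      have := mul_nonneg (h.tr e he).1.le p0
      have := mul_nonneg (h.tr e he).1.le q0
      rintro (h | h) <;> linarith [h.1, h.2]
    · intro e he
      have e1 := h.brFun_le he hv hp
      have e2 := h.brFun_le he hv hq
      have := mul_nonneg (h.br e he).1.le p0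
      have := mul_nonneg (h.br e he).1.le q0
      rintro (h | h) <;> linarith [h.1, h.2]
    · intro w hw
      by_cases hwv : w = v
      · subst hwv
        rintro (h | h) <;> linarith [h.1, h.2]
      · have := hmin w hw hwv p hp p0
        have := hmin w hw hwv q hq q0
        rintro (h | h) <;> linarith [h.1, h.2]
  · intro G G1 G2 G3 G4 hA hB
    refine hφ.frame G G1 G2 G3 (forall_lines ?_ ?_ ?_ ?_ ?_)
    · intro e he
      by_cases hc : e.1 = 1 ∧ v.1 = 0 ∧ e.2 = v.2
      · rw [tlc e he hc]
        exact fun z hz => (G4 z hz).ne'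
      · exact hA e (Finset.mem_filter.2 ⟨he, hc⟩)
    · intro e he
      by_cases hc : e.1 = 1 ∧ v.2 = 0 ∧ e.2 = v.1
      · rw [blc e he hc]
        exact fun z hz => (G4 z hz).ne'
      · exact hB e (Finset.mem_filter.2 ⟨he, hc⟩)
    · intro e he z hz
      have := h.trFun_le he hv (G3 hz)
      have := mul_pos (h.tr e he).1 (G4 z hz)
      linarith
    · intro e he z hz
      have := h.brFun_le he hv (G3 hz)
      have := mul_pos (h.br e he).1 (G4 z hz)
      linarith
    · intro w hw z hz
      by_cases hwv : w = v
      · subst hwv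
        exact (G4 z hz).ne'
      · exact (hmin w hw hwv z (G3 hz) (G4 z hz).le).ne'

lemma foldedAlong_reflect {φ : ℂ → ℂ} (hφ : FoldedAlong openSq φ C.lines) :
    FoldedAlong openSq (fun z => φ (mirror z)) C.reflect.lines := by
  refine hφ.comp mirror (fun z => mirror_mem_openSq) (fun G => convex_image_mirror) ?_
  refine forall_lines ?_ ?_ ?_ ?_ ?_
  · intro e he
    exact ⟨trFun e, Or.inl (Or.inr (Or.inl ⟨e, he, rfl⟩)), 1, one_ne_zero,
      fun z => by simp [trFun]⟩
  · intro e he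
    exact ⟨brFun e, Or.inl (Or.inr (Or.inr ⟨e, he, rfl⟩)), 1, one_ne_zero,
      fun z => by simp [brFun]⟩
  · intro e he
    exact ⟨tlFun e, Or.inl (Or.inl (Or.inl ⟨e, he, rfl⟩)), 1, one_ne_zero,
      fun z => by simp [trFun, mirror_mirror]⟩
  · intro e he
    exact ⟨blFun e, Or.inl (Or.inl (Or.inr ⟨e, he, rfl⟩)), 1, one_ne_zero,
      fun z => by simp [brFun, mirror_mirror]⟩
  · intro v hv
    exact ⟨spanFun (1 - v), Or.inr ⟨1 - v, Finset.mem_image_of_mem _ hv, rfl⟩, -1, by norm_num,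
      fun z => by rw [← mirror_mirror z, spanFun_mirror]; simp [mirror_mirror]⟩

lemma branchLift_right (h : C.Planar) {φ : ℂ → ℂ} (hφ : FoldedAlong openSq φ C.lines) {v : ℝ × ℝ}
    (hv : v ∈ C.V)
    (hmax : ∀ w ∈ C.V, w ≠ v → Beyond openSq (fun z => -spanFun v z) fun z => -spanFun w z) :
    BranchLift openSq φ fun z => -spanFun v z := by
  obtain ⟨t, tc, t0, tp, ti⟩ := branchLift_left h.reflect (foldedAlong_reflect hφ) (v := 1 - v)
    (Finset.mem_image_of_mem _ hv) (by
      intro w hw hwv z hz hz0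
      obtain ⟨w, hw', rfl⟩ := Finset.mem_image.1 hw
      rw [← mirror_mirror z, spanFun_mirror] at hz0 ⊢
      exact hmax w hw' (fun h => hwv (by rw [h])) _ (mirror_mem_openSq hz) hz0)
  refine ⟨fun z => t (mirror z), tc.comp mirror.continuous.continuousOn
    fun z => mirror_mem_openSq, ?_, ?_, ?_⟩
  · intro p hp h
    exact t0 _ (mirror_mem_openSq hp) (by rwa [spanFun_mirror])
  · intro p hp h
    exact tp _ (mirror_mem_openSq hp) (by rwa [spanFun_mirror])
  · intro p hp q hq h1 h2 h3 h4
    exact mirror.injective (ti _ (mirror_mem_openSq hp) _ (mirror_mem_openSq hq)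
      (by rwa [spanFun_mirror]) (by rwa [spanFun_mirror]) (by simpa [mirror_mirror] using h3) h4)

lemma beyond_neg_spanFun {p q : ℝ × ℝ} (h : p ≤ q) (hne : p ≠ q) :
    Beyond openSq (fun z => -spanFun q z) fun z => -spanFun p z := by
  intro z hz h0
  by_contra! h1
  linarith [beyond_spanFun h hne z hz (by linarith)]

lemma exists_height_of_nonempty (h : C.Planar) (hV : C.V.Nonempty) {φ : ℂ → ℂ}
    (hφ : FoldedAlong openSq φ C.lines) :
    ∃ η : ℂ → ℝ, ContinuousOn η openSq ∧
      ∀ p ∈ openSq, ∀ q ∈ openSq, φ p = φ q → η p = η q → p = q := by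
  classical
  obtain ⟨σ, hσ, hmin⟩ : ∃ σ ∈ C.V, ∀ v ∈ C.V, σ ≤ v := by
    obtain ⟨σ, hσ⟩ := C.V.exists_minimal hV
    refine ⟨σ, hσ.1, fun v hv => (h.span_chain σ hσ.1 v hv).elim id fun hh => hσ.2 hv hh⟩
  refine exists_height_of_branchLifts (s := spanFun σ)
    (branchLift_left h hφ hσ fun w hw hne => beyond_spanFun (hmin w hw) hne.symm) ?_
  refine BranchLift.of_chain ((C.V.erase σ).image fun v z => -spanFun v z) _ (by fun_prop)
    ?_ ?_ ?_ ?_ ?_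
  · intro e he
    obtain ⟨v, hv, rfl⟩ := Finset.mem_image.1 he
    fun_prop
  · intro e he
    obtain ⟨v, hv, rfl⟩ := Finset.mem_image.1 he
    exact beyond_neg_spanFun (hmin v (Finset.mem_of_mem_erase hv)) (Finset.ne_of_mem_erase hv).symm
  · intro e he e' he' hne
    obtain ⟨v, hv, rfl⟩ := Finset.mem_image.1 he
    obtain ⟨v', hv', rfl⟩ := Finset.mem_image.1 he'
    have hvv : v ≠ v' := by rintro rfl; exact hne rfl
    exact (h.span_chain v (Finset.mem_of_mem_erase hv) v' (Finset.mem_of_mem_erase hv')).symm.imp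
      (fun h => beyond_neg_spanFun h hvv.symm) fun h => beyond_neg_spanFun h hvv
  · rintro p hp q hq p0 q0 ⟨e, he, pe, qe⟩ hst
    obtain ⟨v, hv, rfl⟩ := Finset.mem_image.1 he
    have hvV := Finset.mem_of_mem_erase hv
    refine hφ.eq_of_eq hp hq (forall_lines ?_ ?_ ?_ ?_ ?_)
    · intro e he
      have := h.tlFun_le he hσ hp
      have := h.tlFun_le he hσ hq
      have := mul_nonneg (h.tl e he).1.le p0
      have := mul_nonneg (h.tl e he).1.le q0
      rintro (h | h) <;> linarith [h.1, h.2]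
    · intro e he
      have := h.blFun_le he hσ hp
      have := h.blFun_le he hσ hq
      have := mul_nonneg (h.bl e he).1.le p0
      have := mul_nonneg (h.bl e he).1.le q0
      rintro (h | h) <;> linarith [h.1, h.2]
    · intro e he
      have := h.trFun_le he hvV hp
      have := h.trFun_le he hvV hq
      have := mul_nonneg (h.tr e he).1.le (by linarith : 0 ≤ spanFun v p)
      have := mul_nonneg (h.tr e he).1.le (by linarith : 0 ≤ spanFun v q)
      rintro (h | h) <;> linarith [h.1, h.2]
    · intro e he
      have := h.brFun_le he hvV hp
      have := h.brFun_le he hvV hq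
      have := mul_nonneg (h.br e he).1.le (by linarith : 0 ≤ spanFun v p)
      have := mul_nonneg (h.br e he).1.le (by linarith : 0 ≤ spanFun v q)
      rintro (h | h) <;> linarith [h.1, h.2]
    · intro w hw
      by_cases hwσ : w = σ
      · subst hwσ
        rintro (h | h) <;> linarith [h.1, h.2]
      · have := hst _ (Finset.mem_image_of_mem _ (Finset.mem_erase.2 ⟨hwσ, hw⟩))
        rwa [straddles_iff_of_eq_mul (c := -1) (e' := spanFun w) (p := p) (q := q) (by norm_num)
          (by ring) (by ring)] at this
  · intro e he hb
    have hne : ∀ {v w : ℝ × ℝ}, w ≠ v → (fun z => -spanFun w z) ≠ fun z => -spanFun v z :=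
      fun hwv hh => hwv (spanFun_injective (funext fun z => neg_injective (congrFun hh z)))
    rcases he with rfl | he
    · refine branchLift_right h hφ hσ fun w hw hwv => ?_
      exact hb _ (Finset.mem_image_of_mem _ (Finset.mem_erase.2 ⟨hwv, hw⟩)) (hne hwv)
    · obtain ⟨v, hv, rfl⟩ := Finset.mem_image.1 he
      refine branchLift_right h hφ (Finset.mem_of_mem_erase hv) fun w hw hwv => ?_
      by_cases hwσ : w = σ
      · subst hwσ
        exact beyond_neg_spanFun (hmin v (Finset.mem_of_mem_erase hv)) hwv
      · exact hb _ (Finset.mem_image_of_mem _ (Finset.mem_erase.2 ⟨hwσ, hw⟩)) (hne hwv)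

/-- A folding along a planar system of chords lifts to an injective map. -/
lemma exists_height (h : C.Planar) (tl_tr : ∀ e ∈ C.TL, ∀ e' ∈ C.TR, e.2 + e'.2 ≤ 1)
    (bl_br : ∀ e ∈ C.BL, ∀ e' ∈ C.BR, e.2 + e'.2 ≤ 1) {φ : ℂ → ℂ}
    (hφ : FoldedAlong openSq φ C.lines) :
    ∃ η : ℂ → ℝ, ContinuousOn η openSq ∧
      ∀ p ∈ openSq, ∀ q ∈ openSq, φ p = φ q → η p = η q → p = q := by
  rcases C.V.eq_empty_or_nonempty with hV | hV
  swap
  · exact exists_height_of_nonempty h hV hφ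
  have key : ∀ A B : Finset (ℝ × ℝ), (∀ e ∈ A, 0 < e.2 ∧ e.2 ≤ 1) → (∀ e ∈ B, 0 < e.2 ∧ e.2 ≤ 1) →
      (∀ e ∈ A, ∀ e' ∈ B, e.2 + e'.2 ≤ 1) →
      ∃ t : ℝ, 0 ≤ t ∧ t ≤ 1 ∧ (∀ e ∈ A, e.2 ≤ t) ∧ ∀ e ∈ B, e.2 ≤ 1 - t := by
    intro A B hA hB hAB
    rcases A.eq_empty_or_nonempty with rfl | hne
    · exact ⟨0, le_rfl, zero_le_one, by simp, fun e he => by linarith [hB e he]⟩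
    · obtain ⟨a, ha, hmax⟩ := A.exists_max_image Prod.snd hne
      exact ⟨a.2, (hA a ha).1.le, (hA a ha).2, hmax, fun e he => by linarith [hAB a ha e he]⟩
  obtain ⟨t, t0, t1, tA, tB⟩ := key C.TL C.TR (fun e he => (h.tl e he).2.2)
    (fun e he => (h.tr e he).2.2) tl_tr
  obtain ⟨s, s0, s1, sA, sB⟩ := key C.BL C.BR (fun e he => (h.bl e he).2.2)
    (fun e he => (h.br e he).2.2) bl_br
  refine exists_height_of_nonempty (C := { C with V := {(s, t)} })
    { h with
      span := by simpa using ⟨s0, s1, t0, t1⟩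
      span_chain := by simp
      tl_span := by simpa using tA
      bl_span := by simpa using sA
      tr_span := by simpa using tB
      br_span := by simpa using sB } (by simp) (hφ.mono ?_)
  exact union_subset_union subset_rfl (by simp [hV])

end ChordSystem

section
open Filter Topology

/-- The signed side of the line through `0` with direction `d`. -/
def side (d z : ℂ) : ℝ := (z * starRingEnd ℂ d).im

lemma side_eq (d z : ℂ) : side d z = z.im * d.re - z.re * d.im := by
  simp [side]; ring

@[fun_prop] lemma continuous_side (d : ℂ) : Continuous (side d) := by
  unfold side; fun_prop

lemma side_add (d z w : ℂ) : side d (z + w) = side d z + side d w := by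
  simp only [side_eq, Complex.add_re, Complex.add_im]; ring

lemma side_sub (d z w : ℂ) : side d (z - w) = side d z - side d w := by
  simp only [side_eq, Complex.sub_re, Complex.sub_im]; ring

lemma side_neg_left (d z : ℂ) : side (-d) z = -side d z := by
  simp only [side_eq, Complex.neg_re, Complex.neg_im]; ring

lemma side_neg (d z : ℂ) : side d (-z) = -side d z := by
  simp only [side_eq, Complex.neg_re, Complex.neg_im]; ring

lemma side_smul (d z : ℂ) (r : ℝ) : side d (r • z) = r * side d z := by
  simp only [side_eq, Complex.smul_re, Complex.smul_im, smul_eq_mul]; ring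

lemma side_smul_left (d z : ℂ) (r : ℝ) : side (r • d) z = r * side d z := by
  simp only [side_eq, Complex.smul_re, Complex.smul_im, smul_eq_mul]; ring

lemma side_self (d : ℂ) : side d d = 0 := by
  simp only [side_eq]; ring

lemma exists_smul_of_side_eq_zero {d e : ℂ} (hd : d ≠ 0) (h : side d e = 0) :
    ∃ r : ℝ, e = r • d := by
  have hn : d.re ^ 2 + d.im ^ 2 ≠ 0 := by
    intro h0
    refine hd (Complex.ext ?_ ?_) <;> simp <;> nlinarith [sq_nonneg d.re, sq_nonneg d.im]
  rw [side_eq] at h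
  refine ⟨(e.re * d.re + e.im * d.im) / (d.re ^ 2 + d.im ^ 2), Complex.ext ?_ ?_⟩
  · simp only [Complex.smul_re, smul_eq_mul]
    field_simp
    linear_combination (-d.im) * h
  · simp only [Complex.smul_im, smul_eq_mul]
    field_simp
    linear_combination d.re * h

lemma isometryEquiv_apply_add_smul (f : ℂ ≃ᵢ ℂ) (p v : ℂ) (t : ℝ) :
    f (p + t • v) = f p + t • (f (p + v) - f p) := by
  have h := f.toRealAffineIsometryEquiv.toAffineEquiv.toAffineMap.apply_lineMap p (p + v) t
  simp only [AffineMap.lineMap_apply, vsub_eq_sub, vadd_eq_add, add_sub_cancel_left] at h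
  rw [add_comm p, add_comm (f p)]
  exact h

lemma isometryEquiv_eq_of_eventually {f g : ℂ ≃ᵢ ℂ} {p d : ℂ}
    (h : ∀ᶠ z in 𝓝 p, 0 ≤ side d (z - p) → f z = g z) : f = g := by
  have hp : f p = g p := h.self_of_nhds (by simp [side])
  have key : ∀ v, 0 ≤ side d v → f (p + v) = g (p + v) := by
    intro v hv
    have ht : Tendsto (fun t : ℝ => p + t • v) (𝓝[>] 0) (𝓝 p) := by
      have : Continuous fun t : ℝ => p + t • v := by fun_prop
      simpa using (this.tendsto 0).mono_left nhdsWithin_le_nhds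
    obtain ⟨t, ht, ht0⟩ := ((ht.eventually h).and self_mem_nhdsWithin).exists
    have ht0 : 0 < t := ht0
    have := ht (by rw [add_sub_cancel_left, side_smul]; positivity)
    rw [isometryEquiv_apply_add_smul, isometryEquiv_apply_add_smul, hp] at this
    have := smul_right_injective ℂ ht0.ne' (add_left_cancel this)
    simpa using this
  ext z
  obtain ⟨v, rfl⟩ : ∃ v, z = p + v := ⟨z - p, by ring⟩
  rcases le_total 0 (side d v) with hv | hv
  · exact key v hv
  · have := key (-v) (by rw [side_neg]; linarith)
    have e : ∀ f : ℂ ≃ᵢ ℂ, f (p + v) = f p - (f (p + -v) - f p) := fun f => by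
      have := isometryEquiv_apply_add_smul f p (-v) (-1)
      simp only [neg_smul, one_smul, neg_neg] at this
      rw [this]
      ring
    rw [e f, e g, this, hp]

/-- `φ` agrees with an isometry near `p`. -/
def Flat (φ : ℂ → ℂ) (p : ℂ) : Prop := ∃ f : ℂ ≃ᵢ ℂ, ∀ᶠ z in 𝓝 p, φ z = f z

/-- `φ` has a crease with direction `d` at `p`. -/
def CreaseDir (φ : ℂ → ℂ) (p d : ℂ) : Prop :=
  d ≠ 0 ∧ ∃ f₁ f₂ : ℂ ≃ᵢ ℂ, f₁ ≠ f₂ ∧ ∀ᶠ z in 𝓝 p,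
    (0 ≤ side d (z - p) → φ z = f₁ z) ∧ (side d (z - p) ≤ 0 → φ z = f₂ z)

variable {φ : ℂ → ℂ}

lemma Flat.not_creaseDir {p d : ℂ} (h : Flat φ p) : ¬ CreaseDir φ p d := by
  rintro ⟨-, f₁, f₂, hne, h'⟩
  obtain ⟨f, hf⟩ := h
  have e1 : f = f₁ := isometryEquiv_eq_of_eventually (p := p) (d := d) (by
    filter_upwards [hf, h'] with z h1 h2 h3
    rw [← h1, h2.1 h3])
  have e2 : f = f₂ := isometryEquiv_eq_of_eventually (p := p) (d := -d) (by
    filter_upwards [hf, h'] with z h1 h2 h3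
    rw [side_neg_left] at h3
    rw [← h1, h2.2 (by linarith)])
  exact hne (e1.symm.trans e2)

lemma CreaseDir.smul {p d : ℂ} (h : CreaseDir φ p d) {r : ℝ} (hr : r ≠ 0) :
    CreaseDir φ p (r • d) := by
  obtain ⟨hd, f₁, f₂, hne, h⟩ := h
  rcases hr.lt_or_gt with hr' | hr'
  · refine ⟨smul_ne_zero hr hd, f₂, f₁, hne.symm, ?_⟩
    filter_upwards [h] with z hz
    rw [side_smul_left]
    exact ⟨fun h => hz.2 (by nlinarith), fun h => hz.1 (by nlinarith)⟩
  · refine ⟨smul_ne_zero hr hd, f₁, f₂, hne, ?_⟩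
    filter_upwards [h] with z hz
    rw [side_smul_left]
    exact ⟨fun h => hz.1 (by nlinarith), fun h => hz.2 (by nlinarith)⟩

lemma CreaseDir.eventually {p d : ℂ} (h : CreaseDir φ p d) : ∀ᶠ z in 𝓝 p,
    (side d (z - p) = 0 → CreaseDir φ z d) ∧ (side d (z - p) ≠ 0 → Flat φ z) := by
  obtain ⟨hd, f₁, f₂, hne, h⟩ := h
  filter_upwards [eventually_eventually_nhds.2 h] with z hz
  refine ⟨fun h0 => ⟨hd, f₁, f₂, hne, ?_⟩, fun h0 => ?_⟩
  · filter_upwards [hz] with w hw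
    have : side d (w - z) = side d (w - p) := by
      rw [side_sub] at h0 ⊢
      rw [side_sub]
      linarith
    rwa [this]
  · rcases lt_or_gt_of_ne h0 with h1 | h1
    · have : ∀ᶠ w in 𝓝 z, side d (w - p) < 0 :=
        (by fun_prop : Continuous fun w => side d (w - p)).continuousAt.eventually_lt
          continuousAt_const h1
      exact ⟨f₂, by filter_upwards [hz, this] with w h2 h3 using h2.2 h3.le⟩
    · have : ∀ᶠ w in 𝓝 z, 0 < side d (w - p) :=
        continuousAt_const.eventually_lt
          (by fun_prop : Continuous fun w => side d (w - p)).continuousAt h1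
      exact ⟨f₁, by filter_upwards [hz, this] with w h2 h3 using h2.1 h3.le⟩

lemma CreaseDir.side_eq_zero {p d v : ℂ} (h : CreaseDir φ p d)
    (hv : ∃ᶠ t : ℝ in 𝓝[≠] 0, ∃ e, CreaseDir φ (p + t • v) e) : side d v = 0 := by
  by_contra h0
  have ht : Tendsto (fun t : ℝ => p + t • v) (𝓝[≠] 0) (𝓝 p) := by
    have : Continuous fun t : ℝ => p + t • v := by fun_prop
    simpa using (this.tendsto 0).mono_left nhdsWithin_le_nhds
  obtain ⟨t, ⟨⟨e, he⟩, h1⟩, ht⟩ :=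
    ((hv.and_eventually (ht.eventually h.eventually)).and_eventually self_mem_nhdsWithin).exists
  refine (h1.2 ?_).not_creaseDir he
  rw [add_sub_cancel_left, side_smul]
  exact mul_ne_zero ht h0

lemma CreaseDir.parallel {p d e : ℂ} (h : CreaseDir φ p d) (h' : CreaseDir φ p e) :
    side d e = 0 := by
  refine h.side_eq_zero ?_
  have ht : Tendsto (fun t : ℝ => p + t • e) (𝓝[≠] 0) (𝓝 p) := by
    have : Continuous fun t : ℝ => p + t • e := by fun_prop
    simpa using (this.tendsto 0).mono_left nhdsWithin_le_nhds
  refine ((ht.eventually h'.eventually).mono fun t ht => ⟨e, ht.1 ?_⟩).frequently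
  rw [add_sub_cancel_left, side_smul, side_self, mul_zero]

lemma CreaseDir.of_parallel {p d e : ℂ} (h : CreaseDir φ p d) (he : e ≠ 0) (h' : side d e = 0) :
    CreaseDir φ p e := by
  obtain ⟨r, rfl⟩ := exists_smul_of_side_eq_zero h.1 h'
  exact h.smul (by rintro rfl; simp at he)

/-- Creases extend across the domain. -/
lemma CreaseDir.extend {Ω : Set ℂ} (hΩ : Convex ℝ Ω)
    (hφ : ∀ p ∈ Ω, Flat φ p ∨ ∃ d, CreaseDir φ p d) {p q d : ℂ} (hp : p ∈ Ω) (hq : q ∈ Ω) (h : CreaseDir φ p d)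
    (hpq : side d (q - p) = 0) : CreaseDir φ q d := by
  refine ((convex_segment p q).isPreconnected.induction₂
    (fun x y => CreaseDir φ x d ↔ CreaseDir φ y d) ?_ (fun x y z _ _ _ h h' => h.trans h')
    (fun x y _ _ h => h.symm) (left_mem_segment ℝ p q) (right_mem_segment ℝ p q)).1 h
  have hseg : ∀ x ∈ segment ℝ p q, side d x = side d p := by
    rintro x ⟨α, β, hα, hβ, hs, rfl⟩
    rw [side_sub] at hpq
    rw [side_add, side_smul, side_smul]
    linear_combination side d p * hs + β * hpq
  intro x hx
  rcases hφ x (hΩ.segment_subset hp hq hx) with ⟨f, hf⟩ | ⟨e, he⟩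
  · have : ∀ᶠ y in 𝓝 x, Flat φ y :=
      (eventually_eventually_nhds.2 hf).mono fun y hy => ⟨f, hy⟩
    filter_upwards [nhdsWithin_le_nhds this] with y hy
    exact iff_of_false this.self_of_nhds.not_creaseDir hy.not_creaseDir
  · filter_upwards [nhdsWithin_le_nhds he.eventually, self_mem_nhdsWithin] with y hy hys
    have hxy : side d (y - x) = 0 := by rw [side_sub, hseg x hx, hseg y hys, sub_self]
    obtain ⟨r, hr⟩ := exists_smul_of_side_eq_zero h.1 hxy
    by_cases hed : side e d = 0
    · refine iff_of_true (he.of_parallel h.1 hed) ((hy.1 ?_).of_parallel h.1 hed)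
      rw [hr, side_smul, hed, mul_zero]
    · by_cases hr0 : r = 0
      · have : y = x := by rwa [hr0, zero_smul, sub_eq_zero] at hr
        rw [this]
      · refine iff_of_false (fun h' => hed (he.parallel h')) (Flat.not_creaseDir (hy.2 ?_))
        rw [hr, side_smul]
        exact mul_ne_zero hr0 hed

/-- A germ of isometries that is locally defined along a connected set is globally defined. -/
lemma exists_common_germ {T H : Set ℂ} (hT : IsPreconnected T) (hTH : T ⊆ H)
    (huniq : ∀ x ∈ T, ∀ f g : ℂ ≃ᵢ ℂ, (∀ᶠ z in 𝓝[H] x, f z = g z) → f = g)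
    (hloc : ∀ x ∈ T, ∃ f : ℂ ≃ᵢ ℂ, ∀ᶠ z in 𝓝[H] x, φ z = f z) :
    ∃ f : ℂ ≃ᵢ ℂ, ∀ x ∈ T, φ x = f x := by
  rcases T.eq_empty_or_nonempty with rfl | ⟨x₀, hx₀⟩
  · exact ⟨IsometryEquiv.refl ℂ, by simp⟩
  obtain ⟨f₀, hf₀⟩ := hloc x₀ hx₀
  refine ⟨f₀, fun x hx => ?_⟩
  suffices ∀ᶠ z in 𝓝[H] x, φ z = f₀ z from this.self_of_nhdsWithin (hTH hx)
  refine (hT.induction₂ (fun x y => ∀ f : ℂ ≃ᵢ ℂ, (∀ᶠ z in 𝓝[H] x, φ z = f z) ↔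
    ∀ᶠ z in 𝓝[H] y, φ z = f z) ?_ (fun x y z _ _ _ h h' f => (h f).trans (h' f))
    (fun x y _ _ h f => (h f).symm) hx₀ hx f₀).1 hf₀
  intro x hx
  obtain ⟨f, hf⟩ := hloc x hx
  filter_upwards [nhdsWithin_mono x hTH (eventually_eventually_nhdsWithin.2 hf),
    self_mem_nhdsWithin] with y hy hyT g
  constructor <;> intro hg
  · rwa [← huniq x hx f g (by filter_upwards [hf, hg] with z h1 h2 using h1.symm.trans h2)]
  · rwa [← huniq y hyT f g (by filter_upwards [hy, hg] with z h1 h2 using h1.symm.trans h2)]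

lemma eventually_dist_eq {p : ℂ} (h : Flat φ p ∨ ∃ d, CreaseDir φ p d) :
    ∀ᶠ z in 𝓝 p, dist (φ z) (φ p) = dist z p := by
  rcases h with ⟨f, hf⟩ | ⟨d, -, f₁, f₂, -, hf⟩
  · filter_upwards [hf] with z hz
    rw [hz, hf.self_of_nhds, f.dist_eq]
  · have h0 := hf.self_of_nhds
    rw [sub_self] at h0
    filter_upwards [hf] with z hz
    rcases le_total 0 (side d (z - p)) with h | h
    · rw [hz.1 h, h0.1 (by simp [side]), f₁.dist_eq]
    · rw [hz.2 h, h0.2 (by simp [side]), f₂.dist_eq]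

lemma exists_isometry_of_flat {G : Set ℂ} (hG : Convex ℝ G) (hf : ∀ p ∈ G, Flat φ p) :
    ∃ f : ℂ ≃ᵢ ℂ, ∀ x ∈ G, φ x = f x :=
  exists_common_germ (H := univ) hG.isPreconnected (subset_univ _)
    (fun x _ f g h => isometryEquiv_eq_of_eventually (p := x) (d := 1) (by
      rw [nhdsWithin_univ] at h
      exact h.mono fun z hz _ => hz))
    (fun x hx => by
      rw [nhdsWithin_univ]
      exact hf x hx)

lemma dist_le_of_locally_folded {Ω : Set ℂ} (hΩ : Convex ℝ Ω)
    (hφ : ∀ p ∈ Ω, Flat φ p ∨ ∃ d, CreaseDir φ p d) {p q : ℂ} (hp : p ∈ Ω) (hq : q ∈ Ω) :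
    dist (φ p) (φ q) ≤ dist p q := by
  let γ : ℝ → ℂ := fun t => p + t • (q - p)
  have hγ : Continuous γ := by fun_prop
  have hγΩ : ∀ t ∈ Icc (0 : ℝ) 1, γ t ∈ Ω := fun t ht =>
    hΩ.segment_subset hp hq (by
      rw [segment_eq_image']
      exact ⟨t, ht, rfl⟩)
  have hloc : ∀ t ∈ Icc (0 : ℝ) 1, ∀ᶠ r in 𝓝 t, dist (φ (γ r)) (φ (γ t)) = |r - t| * dist p q := by
    intro t ht
    filter_upwards [hγ.continuousAt.eventually (eventually_dist_eq (hφ _ (hγΩ t ht)))] with r hr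
    rw [hr, dist_comm p q, dist_eq_norm, dist_eq_norm]
    simp only [γ, add_sub_add_left_eq_sub, ← sub_smul, norm_smul, Real.norm_eq_abs]
  have hcont : ContinuousOn (fun t => φ (γ t)) (Icc 0 1) := by
    intro t ht
    refine ContinuousAt.continuousWithinAt ?_
    rw [ContinuousAt, tendsto_iff_dist_tendsto_zero]
    have h0 : Tendsto (fun r : ℝ => |r - t| * dist p q) (𝓝 t) (𝓝 0) := by
      have : Continuous fun r : ℝ => |r - t| * dist p q := by fun_prop
      simpa using this.tendsto t
    exact h0.congr' ((hloc t ht).mono fun r hr => hr.symm)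
  have := image_le_of_liminf_slope_right_le_deriv_boundary
    (f := fun t => dist (φ (γ t)) (φ p)) (B := fun t => t * dist p q) (B' := fun _ => dist p q)
    (a := 0) (b := 1) (continuousOn_iff_continuous_domRestrict.2
      ((continuousOn_iff_continuous_domRestrict.1 hcont).dist continuous_const)) (by simp [γ])
    (by fun_prop) (fun x _ => by simpa using ((hasDerivAt_id x).mul_const (dist p q)).hasDerivWithinAt)
    (by
      intro x hx r hr
      refine Eventually.frequently ?_
      filter_upwards [nhdsWithin_le_nhds (hloc x ⟨hx.1, hx.2.le⟩), self_mem_nhdsWithin] with z hz hzx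
      have hzx : x < z := hzx
      refine lt_of_le_of_lt ?_ hr
      rw [slope_def_field, div_le_iff₀ (by linarith)]
      rw [abs_of_pos (by linarith)] at hz
      linarith [dist_triangle (φ (γ z)) (φ (γ x)) (φ p)]) (x := 1) (by simp)
  simp only [γ, one_smul, one_mul, add_sub_cancel] at this
  rwa [dist_comm]

lemma continuousOn_of_locally_folded {Ω : Set ℂ} (hΩ : Convex ℝ Ω)
    (hφ : ∀ p ∈ Ω, Flat φ p ∨ ∃ d, CreaseDir φ p d) : ContinuousOn φ Ω :=
  (LipschitzOnWith.of_dist_le_mul (K := 1)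
    (by simpa using fun p hp q hq => dist_le_of_locally_folded hΩ hφ hp hq)).continuousOn

lemma dist_eq_of_creaseDir {Ω : Set ℂ} (hΩ : Convex ℝ Ω)
    (hφ : ∀ p ∈ Ω, Flat φ p ∨ ∃ d, CreaseDir φ p d) {p q d : ℂ} (hp : p ∈ Ω) (hq : q ∈ Ω) (h : CreaseDir φ p d)
    (hpq : side d (q - p) = 0) : dist (φ p) (φ q) = dist p q := by
  have hseg : ∀ x ∈ segment ℝ p q, side d x = side d p := by
    rintro x ⟨α, β, hα, hβ, hs, rfl⟩
    rw [side_sub] at hpq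
    rw [side_add, side_smul, side_smul]
    linear_combination side d p * hs + β * hpq
  have hshift : ∀ x ∈ segment ℝ p q, ∀ z, side d (z - p) = side d (z - x) := fun x hx z => by
    rw [side_sub, side_sub, hseg x hx]
  obtain ⟨f, hf⟩ := exists_common_germ (φ := φ) (T := segment ℝ p q) (H := {z | 0 ≤ side d (z - p)})
    (convex_segment p q).isPreconnected
    (fun x hx => by rw [mem_ofPred_eq, side_sub, hseg x hx, sub_self])
    (fun x hx f g hfg => isometryEquiv_eq_of_eventually (p := x) (d := d) (by
      refine (eventually_nhdsWithin_iff.1 hfg).mono fun z hz h0 => hz ?_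
      rwa [mem_ofPred_eq, hshift x hx]))
    (fun x hx => by
      obtain ⟨-, f₁, f₂, -, hf⟩ := h.extend hΩ hφ hp (hΩ.segment_subset hp hq hx)
        (by rw [side_sub, hseg x hx, sub_self])
      refine ⟨f₁, eventually_nhdsWithin_iff.2 (hf.mono fun z hz h0 => hz.1 ?_)⟩
      rwa [mem_ofPred_eq, hshift x hx] at h0)
  rw [hf p (left_mem_segment ℝ p q), hf q (right_mem_segment ℝ p q), f.dist_eq]

/-- A locally folded map is a folding along any lines that contain all its creases. -/
lemma foldedAlong_of_creases {Ω : Set ℂ} (hΩ : Convex ℝ Ω)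
    (hφ : ∀ p ∈ Ω, Flat φ p ∨ ∃ d, CreaseDir φ p d) {E : Set (ℂ → ℝ)}
    (hE : ∀ x ∈ Ω, ∀ d, CreaseDir φ x d → ∃ e ∈ E, ∃ k : ℝ, k ≠ 0 ∧ ∀ z, e z = k * side d (z - x)) :
    FoldedAlong Ω φ E where
  lip p hp q hq := dist_le_of_locally_folded hΩ hφ hp hq
  frame G h1 h2 h3 h4 := by
    refine exists_isometry_of_flat h2 fun p hp => (hφ p (h3 hp)).resolve_right ?_
    rintro ⟨d, hd⟩
    obtain ⟨e, he, k, hk, hek⟩ := hE p (h3 hp) d hd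
    exact h4 e he p hp (by rw [hek]; simp [side])
  iso p hp q hq hpq := by
    by_cases hc : ∃ x ∈ openSegment ℝ p q, ∃ d, CreaseDir φ x d
    · obtain ⟨x, hx, d, hd⟩ := hc
      have hxΩ : x ∈ Ω := hΩ.openSegment_subset hp hq hx
      have key : side d (p - x) = 0 ∧ side d (q - x) = 0 := by
        obtain ⟨e, he, k, hk, hek⟩ := hE x hxΩ d hd
        obtain ⟨α, β, hα, hβ, hs, rfl⟩ := hx
        have h0 : α * side d (p - (α • p + β • q)) + β * side d (q - (α • p + β • q)) = 0 := by
          simp only [side_sub, side_add, side_smul]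
          linear_combination (-(α * side d p + β * side d q)) * hs
        have h1 := mt (straddles_iff_of_eq_mul (e' := fun z => side d (z - (α • p + β • q)))
          hk (hek p) (hek q)).2 (hpq e he)
        simp only [Straddles] at h1
        set P := side d (p - (α • p + β • q))
        set Q := side d (q - (α • p + β • q))
        push Not at h1
        rcases lt_trichotomy P 0 with hP | hP | hP
        · have := h1.1 hP
          nlinarith
        · refine ⟨hP, ?_⟩
          rw [hP, mul_zero, zero_add] at h0
          exact (mul_eq_zero.1 h0).resolve_left hβ.ne'
        · have := h1.2 hP
          nlinarith
      have hpd : CreaseDir φ p d := hd.extend hΩ hφ hxΩ hp key.1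
      refine dist_eq_of_creaseDir hΩ hφ hp hq hpd ?_
      have := key.2
      have := key.1
      simp only [side_sub] at *
      linarith
    · push Not at hc
      obtain ⟨f, hf⟩ := exists_isometry_of_flat (convex_openSegment p q) fun x hx =>
        (hφ x (hΩ.openSegment_subset hp hq hx)).resolve_right fun ⟨d, hd⟩ => hc x hx d hd
      have hsub : segment ℝ p q ⊆ Ω := hΩ.segment_subset hp hq
      have heq : EqOn φ f (segment ℝ p q) :=
        EqOn.of_subset_closure hf ((continuousOn_of_locally_folded hΩ hφ).mono hsub)
          f.continuous.continuousOn (openSegment_subset_segment ℝ p q)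
          (closure_openSegment p q).ge
      rw [heq (left_mem_segment ℝ p q), heq (right_mem_segment ℝ p q), f.dist_eq]

section
variable {K : Set ℂ}

lemma creasePtOn_iff {z : ℂ} (hz : z ∈ interior K) :
    CreasePtOn K φ z ↔ ∃ d, CreaseDir φ z d := by
  have neg : ∀ d w, w ∈ closedHalfPlane z (-d) ↔ side d (w - z) ≤ 0 := fun d w => by
    change 0 ≤ side (-d) (w - z) ↔ _
    rw [side_neg_left, neg_nonneg]
  constructor
  · rintro ⟨U, hU, d, hd, f₁, f₂, hne, h1, h2⟩
    refine ⟨d, hd, f₁, f₂, hne, ?_⟩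
    filter_upwards [hU, mem_interior_iff_mem_nhds.1 hz] with w hw hwK
    exact ⟨fun h => h1 ⟨⟨hw, hwK⟩, h⟩, fun h => h2 ⟨⟨hw, hwK⟩, (neg d w).2 h⟩⟩
  · rintro ⟨d, hd, f₁, f₂, hne, h⟩
    exact ⟨_, h, d, hd, f₁, f₂, hne, fun w hw => hw.1.1.1 hw.2,
      fun w hw => hw.1.1.2 ((neg d w).1 hw.2)⟩

lemma IsOuterLocalFlatFolding.flat_or_creaseDir (hφ : IsOuterLocalFlatFolding K φ) :
    ∀ p ∈ interior K, Flat φ p ∨ ∃ d, CreaseDir φ p d := by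
  intro p hp
  rcases hφ.classify p (interior_subset hp) with ⟨U, hU, f, hf⟩ | h | h
  · left
    refine ⟨f, ?_⟩
    filter_upwards [hU, mem_interior_iff_mem_nhds.1 hp] with w hw hwK using hf ⟨hw, hwK⟩
  · exact .inr ((creasePtOn_iff hp).1 h)
  · exact absurd hp (hφ.vertex_boundary p (interior_subset hp) h).2

lemma IsCreaseOf.symm {u v : ℂ} (h : IsCreaseOf K φ u v) : IsCreaseOf K φ v u := by
  obtain ⟨h1, h2, h3, h4, h5⟩ := h
  rw [openSegment_symm] at h4 h5
  exact ⟨h2, h1, h3.symm, h4, h5⟩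

lemma IsCreaseOf.creaseDir {u v z : ℂ} (h : IsCreaseOf K φ u v) (hz : z ∈ openSegment ℝ u v) :
    CreaseDir φ z (v - u) := by
  obtain ⟨-, -, hne, hsub, hcr⟩ := h
  obtain ⟨d, hd⟩ := (creasePtOn_iff (hsub hz)).1 (hcr z hz)
  refine hd.of_parallel (sub_ne_zero.2 hne.symm) (hd.side_eq_zero ?_)
  obtain ⟨α, β, hα, hβ, hs, rfl⟩ := hz
  have : ∀ᶠ t : ℝ in 𝓝[≠] 0, -β < t ∧ t < α :=
    nhdsWithin_le_nhds ((lt_mem_nhds (by linarith)).and (gt_mem_nhds (by linarith)))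
  refine (this.mono fun t ht => ?_).frequently
  have hmem : α • u + β • v + t • (v - u) ∈ openSegment ℝ u v :=
    ⟨α - t, β + t, by linarith, by linarith, by linarith, by module⟩
  exact (creasePtOn_iff (hsub hmem)).1 (hcr _ hmem)

lemma exists_frontier_on_ray (hK : IsCompact K) (hc : Convex ℝ K) {x d : ℂ} (hx : x ∈ interior K)
    (hd : d ≠ 0) :
    ∃ t : ℝ, 0 < t ∧ x + t • d ∈ frontier K ∧ ∀ r : ℝ, 0 ≤ r → r < t → x + r • d ∈ interior K := by
  let γ : ℝ → ℂ := fun t => x + t • d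
  have hγ : Continuous γ := by fun_prop
  obtain ⟨R, hR⟩ := hK.isBounded.exists_norm_le
  have hd' : 0 < ‖d‖ := norm_pos_iff.2 hd
  have hS : IsCompact (γ ⁻¹' K ∩ Ici 0) := by
    refine (isCompact_Icc (a := (0 : ℝ)) (b := (R + ‖x‖) / ‖d‖)).of_isClosed_subset
      ((hK.isClosed.preimage hγ).inter isClosed_Ici) fun t ht => ⟨ht.2, ?_⟩
    rw [le_div_iff₀ hd']
    have h1 := norm_sub_le (γ t) x
    have h2 : γ t - x = t • d := by simp [γ]
    rw [h2, norm_smul, Real.norm_of_nonneg ht.2] at h1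
    linarith [hR _ ht.1]
  obtain ⟨t, ⟨htK, ht0⟩, hmax⟩ := hS.exists_isMaxOn
    ⟨0, by simpa [γ] using interior_subset hx, mem_Ici.2 le_rfl⟩ continuousOn_id
  have key : ∀ r : ℝ, 0 ≤ r → γ r ∈ interior K → r < t := by
    intro r hr hrK
    have : ∀ᶠ s in 𝓝[>] r, γ s ∈ K :=
      nhdsWithin_le_nhds (hγ.continuousAt.eventually (mem_interior_iff_mem_nhds.1 hrK))
    obtain ⟨s, hs, hrs⟩ := (this.and self_mem_nhdsWithin).exists
    have hrs : r < s := hrs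
    exact hrs.trans_le (hmax ⟨hs, hr.trans hrs.le⟩)
  have htpos : 0 < t := key 0 le_rfl (by simpa [γ] using hx)
  refine ⟨t, htpos, ⟨subset_closure htK, fun h => (key t ht0 h).false⟩, fun r hr hrt => ?_⟩
  rcases hr.eq_or_lt with rfl | hr
  · simpa using hx
  · refine hc.openSegment_interior_self_subset_interior hx htK
      ⟨1 - r / t, r / t, ?_, by positivity, by ring, ?_⟩
    · rw [sub_pos, div_lt_one htpos]
      exact hrt
    · simp only [γ, smul_add, smul_smul, div_mul_cancel₀ _ htpos.ne']
      module

lemma IsOuterLocalFlatFolding.exists_crease (hφ : IsOuterLocalFlatFolding K φ) {x d : ℂ}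
    (hx : x ∈ interior K) (h : CreaseDir φ x d) :
    ∃ u v, IsCreaseOf K φ u v ∧ ∃ k : ℝ, k ≠ 0 ∧ v - u = k • d ∧ side d (x - u) = 0 := by
  obtain ⟨t, ht, htf, hti⟩ := exists_frontier_on_ray hφ.compact hφ.convex hx h.1
  obtain ⟨s, hs, hsf, hsi⟩ := exists_frontier_on_ray hφ.compact hφ.convex hx (neg_ne_zero.2 h.1)
  have hvu : x + t • d - (x + s • -d) = (t + s) • d := by module
  have hseg : ∀ z ∈ openSegment ℝ (x + s • -d) (x + t • d),
      z ∈ interior K ∧ side d (z - x) = 0 := by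
    rintro z ⟨α, β, hα, hβ, hab, rfl⟩
    have e : α • (x + s • -d) + β • (x + t • d) = x + (β * t - α * s) • d := by
      obtain rfl : α = 1 - β := by linarith
      module
    rw [e, add_sub_cancel_left, side_smul, side_self, mul_zero]
    refine ⟨?_, rfl⟩
    rcases le_total 0 (β * t - α * s) with h0 | h0
    · exact hti _ h0 (by nlinarith [mul_pos hα hs, mul_pos hα ht])
    · have := hsi (-(β * t - α * s)) (by linarith) (by nlinarith [mul_pos hβ hs, mul_pos hβ ht])
      rwa [smul_neg, neg_smul, neg_neg] at this
  refine ⟨x + s • -d, x + t • d, ⟨hsf, htf, fun he => ?_, fun z hz => (hseg z hz).1,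
    fun z hz => (creasePtOn_iff (hseg z hz).1).2 ⟨d, h.extend hφ.convex.interior
      hφ.flat_or_creaseDir hx (hseg z hz).1 (hseg z hz).2⟩⟩, t + s, by positivity, hvu, ?_⟩
  · rw [he, sub_self] at hvu
    exact smul_ne_zero (by positivity) h.1 hvu.symm
  · have : x - (x + s • -d) = s • d := by module
    rw [this, side_smul, side_self, mul_zero]

/-- Two creases do not cross. -/
lemma IsOuterLocalFlatFolding.not_cross (hφ : IsOuterLocalFlatFolding K φ) {u v u' v' : ℂ}
    (h : IsCreaseOf K φ u v) (h' : IsCreaseOf K φ u' v') :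
    ¬ (side (v - u) (u' - u) < 0 ∧ 0 < side (v - u) (v' - u)) := by
  rintro ⟨hP, hQ⟩
  set P := side (v - u) (u' - u) with hPdef
  set Q := side (v - u) (v' - u) with hQdef
  have hQP : 0 < Q - P := by linarith
  have hz : (Q / (Q - P)) • u' + (-P / (Q - P)) • v' ∈ openSegment ℝ u' v' :=
    ⟨_, _, by positivity, div_pos (by linarith) hQP, by field_simp; ring, rfl⟩
  have hm : (1 / 2 : ℝ) • u + (1 / 2 : ℝ) • v ∈ openSegment ℝ u v :=
    ⟨_, _, by norm_num, by norm_num, by norm_num, rfl⟩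
  have h1 := (h.creaseDir hm).extend hφ.convex.interior hφ.flat_or_creaseDir (h.2.2.2.1 hm)
    (h'.2.2.2.1 hz) (by
      have e : side (v - u) v = side (v - u) u := by
        have := side_self (v - u)
        rw [side_sub] at this
        linarith
      rw [side_sub] at hPdef hQdef
      simp only [side_sub _ _ (_ + _), side_add, side_smul, e]
      field_simp
      linear_combination (-2 * Q) * hPdef + 2 * P * hQdef)
  have h2 := h1.parallel (h'.creaseDir hz)
  rw [side_sub] at h2 hPdef hQdef
  linarith

lemma finite_creases (hfin : {s : Set ℂ | ∃ a b : ℂ, IsCreaseOf K φ a b ∧ s = segment ℝ a b}.Finite) :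
    {p : ℂ × ℂ | IsCreaseOf K φ p.1 p.2}.Finite := by
  have hT : (⋃ s ∈ {s : Set ℂ | ∃ a b : ℂ, IsCreaseOf K φ a b ∧ s = segment ℝ a b},
      s ∩ frontier K).Finite := by
    refine hfin.biUnion ?_
    rintro _ ⟨a, b, h, rfl⟩
    refine (Set.toFinite {a, b}).subset fun x ⟨hx, hxf⟩ => ?_
    rw [← insert_endpoints_openSegment] at hx
    rcases hx with rfl | rfl | hx
    · simp
    · simp
    · exact absurd (h.2.2.2.1 hx) hxf.2
  refine (hT.prod hT).subset fun p hp => ⟨?_, ?_⟩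
  · exact mem_biUnion ⟨_, _, hp, rfl⟩ ⟨left_mem_segment _ _ _, hp.1⟩
  · exact mem_biUnion ⟨_, _, hp, rfl⟩ ⟨right_mem_segment _ _ _, hp.2.1⟩

lemma IsOuterLocalFlatFolding.foldedAlong (hφ : IsOuterLocalFlatFolding K φ) {E : Set (ℂ → ℝ)}
    (hE : ∀ u v, IsCreaseOf K φ u v →
      ∃ e ∈ E, ∃ k : ℝ, k ≠ 0 ∧ ∀ z, e z = k * side (v - u) (z - u)) :
    FoldedAlong (interior K) φ E :=
  foldedAlong_of_creases hφ.convex.interior hφ.flat_or_creaseDir fun x hx d hd => by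
    obtain ⟨u, v, h, k, hk, hvu, hxu⟩ := hφ.exists_crease hx hd
    obtain ⟨e, he, l, hl, hel⟩ := hE u v h
    refine ⟨e, he, l * k, mul_ne_zero hl hk, fun z => ?_⟩
    rw [side_sub] at hxu
    rw [hel, hvu, side_smul_left, side_sub, side_sub]
    linear_combination (l * k) * hxu

end

end

/-- `φ` is a folding of the open unit square whose creases are the chords with endpoints
related by `cr`. -/
structure IsChordFolding (φ : ℂ → ℂ) (cr : ℂ → ℂ → Prop) : Prop where
  symm : ∀ u v, cr u v → cr v u
  mem : ∀ u v, cr u v → (0 ≤ u.re ∧ u.re ≤ 1) ∧ (0 ≤ u.im ∧ u.im ≤ 1) ∧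
    (u.re = 0 ∨ u.re = 1 ∨ u.im = 0 ∨ u.im = 1)
  mid : ∀ u v, cr u v → (0 < u.re + v.re ∧ u.re + v.re < 2) ∧ (0 < u.im + v.im ∧ u.im + v.im < 2)
  cross : ∀ u v u' v', cr u v → cr u' v' → ¬ (side (v - u) (u' - u) < 0 ∧ 0 < side (v - u) (v' - u))
  finite : {p : ℂ × ℂ | cr p.1 p.2}.Finite
  folded : ∀ E : Set (ℂ → ℝ), (∀ u v, cr u v →
    ∃ e ∈ E, ∃ k : ℝ, k ≠ 0 ∧ ∀ z, e z = k * side (v - u) (z - u)) → FoldedAlong openSq φ E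

lemma tlFun_eq_side (p : ℝ × ℝ) (z : ℂ) :
    tlFun p z = 1 * side ((⟨p.2, 1⟩ : ℂ) - ⟨0, 1 - p.1⟩) (z - ⟨0, 1 - p.1⟩) := by
  simp [tlFun, side_eq]; ring

lemma blFun_eq_side (p : ℝ × ℝ) (z : ℂ) :
    blFun p z = -1 * side ((⟨p.2, 0⟩ : ℂ) - ⟨0, p.1⟩) (z - ⟨0, p.1⟩) := by
  simp [blFun, side_eq]; ring

lemma trFun_eq_side (p : ℝ × ℝ) (z : ℂ) :
    trFun p z = -1 * side ((⟨1 - p.2, 1⟩ : ℂ) - ⟨1, 1 - p.1⟩) (z - ⟨1, 1 - p.1⟩) := by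
  simp [trFun, tlFun, mirror_apply, side_eq]; ring

lemma brFun_eq_side (p : ℝ × ℝ) (z : ℂ) :
    brFun p z = 1 * side ((⟨1 - p.2, 0⟩ : ℂ) - ⟨1, p.1⟩) (z - ⟨1, p.1⟩) := by
  simp [brFun, blFun, mirror_apply, side_eq]; ring

lemma spanFun_eq_side (v : ℝ × ℝ) (z : ℂ) :
    spanFun v z = 1 * side ((⟨v.2, 1⟩ : ℂ) - ⟨v.1, 0⟩) (z - ⟨v.1, 0⟩) := by
  simp [spanFun, side_eq]; ring

lemma le_or_le_of_not_straddles {e : ℂ → ℝ} {a b a' b' : ℝ} {u v : ℂ} (ha : 0 < a) (hb : 0 < b)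
    (hu : e u = b * (a - a')) (hv : e v = a * (b - b')) (h : ¬ Straddles e u v) :
    (a, b) ≤ (a', b') ∨ (a', b') ≤ (a, b) := by
  simp only [Prod.mk_le_mk]
  by_contra! hc
  apply h
  rw [Straddles, hu, hv]
  rcases lt_or_ge a' a with h1 | h1
  · have h2 : b < b' := hc.2 h1.le
    exact .inr ⟨mul_pos hb (by linarith), by nlinarith⟩
  · rcases h1.eq_or_lt with rfl | h1
    · exact absurd (hc.1 le_rfl) (by linarith [hc.2 le_rfl])
    · exact .inl ⟨by nlinarith, mul_pos ha (by linarith [hc.1 h1.le])⟩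

namespace IsChordFolding

variable {φ : ℂ → ℂ} {cr : ℂ → ℂ → Prop}

lemma not_straddles (h : IsChordFolding φ cr) {u v u' v' : ℂ} {e : ℂ → ℝ} (hc : cr u v)
    (hc' : cr u' v') {k : ℝ} (he : ∀ z, e z = k * side (v - u) (z - u)) :
    ¬ Straddles e u' v' := by
  have h1 := h.cross u v u' v' hc hc'
  have h2 := h.cross u v v' u' hc (h.symm _ _ hc')
  intro hs
  have hk : k ≠ 0 := by
    rintro rfl
    simp [Straddles, he] at hs
  rcases (straddles_iff_of_eq_mul (e' := fun z => side (v - u) (z - u)) hk (he _) (he _)).1 hs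
    with h3 | h3
  · exact h1 h3
  · exact h2 h3.symm

lemma finite_params (h : IsChordFolding φ cr) (f g : ℝ → ℂ) (hf : f.Injective) (hg : g.Injective)
    (R : ℝ × ℝ → Prop) : {p : ℝ × ℝ | R p ∧ cr (f p.1) (g p.2)}.Finite := by
  have hinj : Function.Injective fun p : ℝ × ℝ => (f p.1, g p.2) := hf.prodMap hg
  exact (h.finite.preimage hinj.injOn).subset fun p hp => hp.2

/-- The admissible parameters of chords cutting off a corner. -/
def CornerRange (p : ℝ × ℝ) : Prop := 0 < p.1 ∧ p.1 ≤ 1 ∧ 0 < p.2 ∧ p.2 ≤ 1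

/-- The admissible parameters of chords joining opposite sides. -/
def SpanRange (p : ℝ × ℝ) : Prop := 0 < p.1 ∧ p.1 < 1 ∧ 0 < p.2 ∧ p.2 < 1

lemma finite_tl (h : IsChordFolding φ cr) :
    {p : ℝ × ℝ | CornerRange p ∧ cr ⟨0, 1 - p.1⟩ ⟨p.2, 1⟩}.Finite :=
  h.finite_params (fun a => ⟨0, 1 - a⟩) (fun b => ⟨b, 1⟩) (fun x y hxy => by simpa using hxy)
    (fun x y hxy => by simpa using hxy) _

lemma finite_bl (h : IsChordFolding φ cr) :
    {p : ℝ × ℝ | CornerRange p ∧ cr ⟨0, p.1⟩ ⟨p.2, 0⟩}.Finite :=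
  h.finite_params (fun a => ⟨0, a⟩) (fun b => ⟨b, 0⟩) (fun x y hxy => by simpa using hxy)
    (fun x y hxy => by simpa using hxy) _

lemma finite_tr (h : IsChordFolding φ cr) :
    {p : ℝ × ℝ | CornerRange p ∧ cr ⟨1, 1 - p.1⟩ ⟨1 - p.2, 1⟩}.Finite :=
  h.finite_params (fun a => ⟨1, 1 - a⟩) (fun b => ⟨1 - b, 1⟩) (fun x y hxy => by simpa using hxy)
    (fun x y hxy => by simpa using hxy) _

lemma finite_br (h : IsChordFolding φ cr) :
    {p : ℝ × ℝ | CornerRange p ∧ cr ⟨1, p.1⟩ ⟨1 - p.2, 0⟩}.Finite :=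
  h.finite_params (fun a => ⟨1, a⟩) (fun b => ⟨1 - b, 0⟩) (fun x y hxy => by simpa using hxy)
    (fun x y hxy => by simpa using hxy) _

lemma finite_span (h : IsChordFolding φ cr) :
    {p : ℝ × ℝ | SpanRange p ∧ cr ⟨p.1, 0⟩ ⟨p.2, 1⟩}.Finite :=
  h.finite_params (fun a => ⟨a, 0⟩) (fun b => ⟨b, 1⟩) (fun x y hxy => by simpa using hxy)
    (fun x y hxy => by simpa using hxy) _

/-- The chords, other than those joining the left and right sides, sorted by the sides that
they join. -/
def chords (h : IsChordFolding φ cr) : ChordSystem where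
  TL := h.finite_tl.toFinset
  BL := h.finite_bl.toFinset
  TR := h.finite_tr.toFinset
  BR := h.finite_br.toFinset
  V := h.finite_span.toFinset

lemma mem_TL (h : IsChordFolding φ cr) {p : ℝ × ℝ} :
    p ∈ h.chords.TL ↔ CornerRange p ∧ cr ⟨0, 1 - p.1⟩ ⟨p.2, 1⟩ := by simp [chords]

lemma mem_BL (h : IsChordFolding φ cr) {p : ℝ × ℝ} :
    p ∈ h.chords.BL ↔ CornerRange p ∧ cr ⟨0, p.1⟩ ⟨p.2, 0⟩ := by simp [chords]

lemma mem_TR (h : IsChordFolding φ cr) {p : ℝ × ℝ} :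
    p ∈ h.chords.TR ↔ CornerRange p ∧ cr ⟨1, 1 - p.1⟩ ⟨1 - p.2, 1⟩ := by simp [chords]

lemma mem_BR (h : IsChordFolding φ cr) {p : ℝ × ℝ} :
    p ∈ h.chords.BR ↔ CornerRange p ∧ cr ⟨1, p.1⟩ ⟨1 - p.2, 0⟩ := by simp [chords]

lemma mem_V (h : IsChordFolding φ cr) {p : ℝ × ℝ} :
    p ∈ h.chords.V ↔ SpanRange p ∧ cr ⟨p.1, 0⟩ ⟨p.2, 1⟩ := by simp [chords]

lemma not_straddles_tl (h : IsChordFolding φ cr) {p : ℝ × ℝ} (hp : p ∈ h.chords.TL) {u v : ℂ}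
    (hc : cr u v) : ¬ Straddles (tlFun p) u v :=
  h.not_straddles (h.mem_TL.1 hp).2 hc (tlFun_eq_side p)

lemma not_straddles_bl (h : IsChordFolding φ cr) {p : ℝ × ℝ} (hp : p ∈ h.chords.BL) {u v : ℂ}
    (hc : cr u v) : ¬ Straddles (blFun p) u v :=
  h.not_straddles (h.mem_BL.1 hp).2 hc (blFun_eq_side p)

lemma not_straddles_tr (h : IsChordFolding φ cr) {p : ℝ × ℝ} (hp : p ∈ h.chords.TR) {u v : ℂ}
    (hc : cr u v) : ¬ Straddles (trFun p) u v :=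
  h.not_straddles (h.mem_TR.1 hp).2 hc (trFun_eq_side p)

lemma not_straddles_br (h : IsChordFolding φ cr) {p : ℝ × ℝ} (hp : p ∈ h.chords.BR) {u v : ℂ}
    (hc : cr u v) : ¬ Straddles (brFun p) u v :=
  h.not_straddles (h.mem_BR.1 hp).2 hc (brFun_eq_side p)

lemma planar (h : IsChordFolding φ cr) : h.chords.Planar where
  tl e he := (h.mem_TL.1 he).1
  bl e he := (h.mem_BL.1 he).1
  tr e he := (h.mem_TR.1 he).1
  br e he := (h.mem_BR.1 he).1
  span v hv := by
    obtain ⟨h1, h2, h3, h4⟩ := (h.mem_V.1 hv).1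
    exact ⟨h1.le, h2.le, h3.le, h4.le⟩
  tl_chain e he e' he' := by
    obtain ⟨h1, h2, h3, h4⟩ := (h.mem_TL.1 he).1
    exact le_or_le_of_not_straddles h1 h3 (by simp [tlFun]; ring) (by simp [tlFun]; ring)
      (h.not_straddles_tl he (h.mem_TL.1 he').2)
  bl_chain e he e' he' := by
    obtain ⟨h1, h2, h3, h4⟩ := (h.mem_BL.1 he).1
    exact le_or_le_of_not_straddles h1 h3 (by simp [blFun]; ring) (by simp [blFun]; ring)
      (h.not_straddles_bl he (h.mem_BL.1 he').2)
  tr_chain e he e' he' := by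
    obtain ⟨h1, h2, h3, h4⟩ := (h.mem_TR.1 he).1
    exact le_or_le_of_not_straddles h1 h3 (by simp [trFun, mirror_apply, tlFun]; ring)
      (by simp [trFun, mirror_apply, tlFun]; ring) (h.not_straddles_tr he (h.mem_TR.1 he').2)
  br_chain e he e' he' := by
    obtain ⟨h1, h2, h3, h4⟩ := (h.mem_BR.1 he).1
    exact le_or_le_of_not_straddles h1 h3 (by simp [brFun, mirror_apply, blFun]; ring)
      (by simp [brFun, mirror_apply, blFun]; ring) (h.not_straddles_br he (h.mem_BR.1 he').2)
  span_chain v hv v' hv' := by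
    refine or_iff_not_imp_left.2 fun hle => ?_
    have := h.not_straddles (h.mem_V.1 hv).2 (h.mem_V.1 hv').2 (spanFun_eq_side v)
    simp only [Straddles, spanFun] at this
    push Not at this
    rw [Prod.le_def] at hle ⊢
    by_contra hge
    rcases lt_trichotomy v.1 v'.1 with h1 | h1 | h1 <;> grind
  tl_bl e he e' he' := by
    obtain ⟨h1, h2, h3, h4⟩ := (h.mem_TL.1 he).1
    obtain ⟨⟨h5, h6, h7, h8⟩, hc⟩ := h.mem_BL.1 he'
    by_contra! h0
    exact h.not_straddles_tl he hc (.inr (by simp [tlFun]; constructor <;> nlinarith [mul_pos h1 h7]))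
  tr_br e he e' he' := by
    obtain ⟨h1, h2, h3, h4⟩ := (h.mem_TR.1 he).1
    obtain ⟨⟨h5, h6, h7, h8⟩, hc⟩ := h.mem_BR.1 he'
    by_contra! h0
    exact h.not_straddles_tr he hc
      (.inr (by simp [trFun, mirror_apply, tlFun]; constructor <;> nlinarith [mul_pos h1 h7]))
  tl_span e he v hv := by
    obtain ⟨h1, h2, h3, h4⟩ := (h.mem_TL.1 he).1
    obtain ⟨⟨h5, h6, h7, h8⟩, hc⟩ := h.mem_V.1 hv
    by_contra! h0
    exact h.not_straddles_tl he hc (.inl (by simp [tlFun]; constructor <;> nlinarith [mul_pos h1 h5]))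
  bl_span e he v hv := by
    obtain ⟨h1, h2, h3, h4⟩ := (h.mem_BL.1 he).1
    obtain ⟨⟨h5, h6, h7, h8⟩, hc⟩ := h.mem_V.1 hv
    by_contra! h0
    exact h.not_straddles_bl he hc (.inr (by simp [blFun]; constructor <;> nlinarith [mul_pos h1 h7]))
  tr_span e he v hv := by
    obtain ⟨h1, h2, h3, h4⟩ := (h.mem_TR.1 he).1
    obtain ⟨⟨h5, h6, h7, h8⟩, hc⟩ := h.mem_V.1 hv
    by_contra! h0
    exact h.not_straddles_tr he hc (.inl (by
      simp [trFun, mirror_apply, tlFun]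
      constructor <;> nlinarith [mul_pos h1 (sub_pos.2 h6)]))
  br_span e he v hv := by
    obtain ⟨h1, h2, h3, h4⟩ := (h.mem_BR.1 he).1
    obtain ⟨⟨h5, h6, h7, h8⟩, hc⟩ := h.mem_V.1 hv
    by_contra! h0
    exact h.not_straddles_br he hc (.inr (by
      simp [brFun, mirror_apply, blFun]
      constructor <;> nlinarith [mul_pos h1 (sub_pos.2 h8)]))

lemma tl_tr (h : IsChordFolding φ cr) : ∀ e ∈ h.chords.TL, ∀ e' ∈ h.chords.TR, e.2 + e'.2 ≤ 1 := by
  intro e he e' he'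
  obtain ⟨h1, h2, h3, h4⟩ := (h.mem_TL.1 he).1
  obtain ⟨⟨h5, h6, h7, h8⟩, hc⟩ := h.mem_TR.1 he'
  by_contra! h0
  exact h.not_straddles_tl he hc (.inl (by simp [tlFun]; constructor <;> nlinarith [mul_pos h3 h5]))

lemma bl_br (h : IsChordFolding φ cr) : ∀ e ∈ h.chords.BL, ∀ e' ∈ h.chords.BR, e.2 + e'.2 ≤ 1 := by
  intro e he e' he'
  obtain ⟨h1, h2, h3, h4⟩ := (h.mem_BL.1 he).1
  obtain ⟨⟨h5, h6, h7, h8⟩, hc⟩ := h.mem_BR.1 he'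
  by_contra! h0
  exact h.not_straddles_bl he hc (.inl (by simp [blFun]; constructor <;> nlinarith [mul_pos h3 h5]))

/-- Chords joining two pairs of opposite sides would cross. -/
lemma not_both_spans (h : IsChordFolding φ cr) {a b : ℝ × ℝ} (ha : SpanRange a)
    (hac : cr ⟨a.1, 0⟩ ⟨a.2, 1⟩) (hb : SpanRange b) : ¬ cr ⟨0, b.1⟩ ⟨1, b.2⟩ := by
  intro hbc
  obtain ⟨h1, h2, h3, h4⟩ := ha
  obtain ⟨h5, h6, h7, h8⟩ := hb
  refine h.not_straddles hac hbc (spanFun_eq_side a) (.inr ?_)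
  simp only [spanFun]
  constructor <;> nlinarith [mul_pos h1 h5, mul_pos h3 h5, mul_pos h1 h7, mul_pos h3 h7]

lemma exists_line (h : IsChordFolding φ cr)
    (hH : ∀ b : ℝ × ℝ, SpanRange b → ¬ cr ⟨0, b.1⟩ ⟨1, b.2⟩) {u v : ℂ} (huv : cr u v) :
    ∃ e ∈ h.chords.lines, ∃ k : ℝ, k ≠ 0 ∧ ∀ z, e z = k * side (v - u) (z - u) := by
  let Hit : ℂ → ℂ → Prop := fun u v =>
    ∃ e ∈ h.chords.lines, ∃ k : ℝ, k ≠ 0 ∧ ∀ z, e z = k * side (v - u) (z - u)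
  have swap : ∀ u v, Hit v u → Hit u v := by
    rintro u v ⟨e, he, k, hk, hek⟩
    refine ⟨e, he, -k, neg_ne_zero.2 hk, fun z => ?_⟩
    rw [hek]
    simp only [side_eq, Complex.sub_re, Complex.sub_im]
    ring
  have one : (1 : ℝ) ≠ 0 := one_ne_zero
  have none : (-1 : ℝ) ≠ 0 := by norm_num
  have tl : ∀ u v, cr u v → u.re = 0 → v.im = 1 → Hit u v := by
    rintro ⟨x, y⟩ ⟨x', y'⟩ hc rfl rfl
    have hm := h.mid _ _ hc
    have h1 := h.mem _ _ hc
    have h2 := h.mem _ _ (h.symm _ _ hc)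
    simp only at hm h1 h2
    have hp : (1 - y, x') ∈ h.chords.TL := h.mem_TL.2
      ⟨⟨by linarith, by linarith, by linarith, by linarith⟩, by simpa using hc⟩
    exact ⟨_, .inl (.inl (.inl ⟨_, hp, rfl⟩)), 1, one,
      fun z => (tlFun_eq_side _ z).trans (by simp)⟩
  have bl : ∀ u v, cr u v → u.re = 0 → v.im = 0 → Hit u v := by
    rintro ⟨x, y⟩ ⟨x', y'⟩ hc rfl rfl
    have hm := h.mid _ _ hc
    have h1 := h.mem _ _ hc
    have h2 := h.mem _ _ (h.symm _ _ hc)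
    simp only at hm h1 h2
    have hp : (y, x') ∈ h.chords.BL := h.mem_BL.2
      ⟨⟨by linarith, by linarith, by linarith, by linarith⟩, hc⟩
    exact ⟨_, .inl (.inl (.inr ⟨_, hp, rfl⟩)), -1, none, blFun_eq_side _⟩
  have tr : ∀ u v, cr u v → u.re = 1 → v.im = 1 → Hit u v := by
    rintro ⟨x, y⟩ ⟨x', y'⟩ hc rfl rfl
    have hm := h.mid _ _ hc
    have h1 := h.mem _ _ hc
    have h2 := h.mem _ _ (h.symm _ _ hc)
    simp only at hm h1 h2
    have hp : (1 - y, 1 - x') ∈ h.chords.TR := h.mem_TR.2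
      ⟨⟨by linarith, by linarith, by linarith, by linarith⟩, by simpa using hc⟩
    exact ⟨_, .inl (.inr (.inl ⟨_, hp, rfl⟩)), -1, none,
      fun z => (trFun_eq_side _ z).trans (by simp)⟩
  have br : ∀ u v, cr u v → u.re = 1 → v.im = 0 → Hit u v := by
    rintro ⟨x, y⟩ ⟨x', y'⟩ hc rfl rfl
    have hm := h.mid _ _ hc
    have h1 := h.mem _ _ hc
    have h2 := h.mem _ _ (h.symm _ _ hc)
    simp only at hm h1 h2
    have hp : (y, 1 - x') ∈ h.chords.BR := h.mem_BR.2
      ⟨⟨by linarith, by linarith, by linarith, by linarith⟩, by simpa using hc⟩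
    exact ⟨_, .inl (.inr (.inr ⟨_, hp, rfl⟩)), 1, one,
      fun z => (brFun_eq_side _ z).trans (by simp)⟩
  have lr : ∀ u v, cr u v → u.re = 0 → v.re = 1 → Hit u v := by
    intro u v hc hu hv
    have hc' := h.symm _ _ hc
    obtain ⟨-, ⟨u0, u1⟩, -⟩ := h.mem _ _ hc
    obtain ⟨-, ⟨v0, v1⟩, -⟩ := h.mem _ _ hc'
    rcases u0.eq_or_lt with hu0 | hu0
    · exact swap _ _ (br v u hc' hv hu0.symm)
    rcases u1.eq_or_lt with hu1 | hu1
    · exact swap _ _ (tr v u hc' hv hu1)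
    rcases v0.eq_or_lt with hv0 | hv0
    · exact bl u v hc hu hv0.symm
    rcases v1.eq_or_lt with hv1 | hv1
    · exact tl u v hc hu hv1
    refine absurd ?_ (hH (u.im, v.im) ⟨hu0, hu1, hv0, hv1⟩)
    convert hc using 1 <;> apply Complex.ext <;> simp [hu, hv]
  have bt : ∀ u v, cr u v → u.im = 0 → v.im = 1 → Hit u v := by
    intro u v hc hu hv
    have hc' := h.symm _ _ hc
    obtain ⟨⟨u0, u1⟩, -⟩ := h.mem _ _ hc
    obtain ⟨⟨v0, v1⟩, -⟩ := h.mem _ _ hc'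
    rcases u0.eq_or_lt with hu0 | hu0
    · exact tl u v hc hu0.symm hv
    rcases u1.eq_or_lt with hu1 | hu1
    · exact tr u v hc hu1 hv
    rcases v0.eq_or_lt with hv0 | hv0
    · exact swap _ _ (bl v u hc' hv0.symm hu)
    rcases v1.eq_or_lt with hv1 | hv1
    · exact swap _ _ (br v u hc' hv1 hu)
    have eu : (⟨u.re, 0⟩ : ℂ) = u := Complex.ext rfl hu.symm
    have ev : (⟨v.re, 1⟩ : ℂ) = v := Complex.ext rfl hv.symm
    have hp : (u.re, v.re) ∈ h.chords.V :=
      h.mem_V.2 ⟨⟨hu0, hu1, hv0, hv1⟩, by simpa only [eu, ev] using hc⟩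
    refine ⟨_, .inr ⟨_, hp, rfl⟩, 1, one, fun z => (spanFun_eq_side _ z).trans ?_⟩
    rw [eu, ev]
  have hc := huv
  have hc' := h.symm _ _ hc
  obtain ⟨⟨m1, m2⟩, m3, m4⟩ := h.mid _ _ hc
  obtain ⟨-, -, hu⟩ := h.mem _ _ hc
  obtain ⟨-, -, hv⟩ := h.mem _ _ hc'
  change Hit u v
  rcases hu with hu | hu | hu | hu <;> rcases hv with hv | hv | hv | hv
  · linarith
  · exact lr u v hc hu hv
  · exact bl u v hc hu hv
  · exact tl u v hc hu hv
  · exact swap _ _ (lr v u hc' hv hu)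
  · linarith
  · exact br u v hc hu hv
  · exact tr u v hc hu hv
  · exact swap _ _ (bl v u hc' hv hu)
  · exact swap _ _ (br v u hc' hv hu)
  · linarith
  · exact bt u v hc hu hv
  · exact swap _ _ (tl v u hc' hv hu)
  · exact swap _ _ (tr v u hc' hv hu)
  · exact swap _ _ (bt v u hc' hv hu)
  · linarith

/-- A folding without creases joining the left and right sides is realized by a height
function. -/
lemma exists_height (h : IsChordFolding φ cr)
    (hH : ∀ b : ℝ × ℝ, SpanRange b → ¬ cr ⟨0, b.1⟩ ⟨1, b.2⟩) :
    ∃ η : ℂ → ℝ, ContinuousOn η openSq ∧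
      ∀ p ∈ openSq, ∀ q ∈ openSq, φ p = φ q → η p = η q → p = q :=
  ChordSystem.exists_height h.planar h.tl_tr h.bl_br
    (h.folded _ fun _ _ huv => h.exists_line hH huv)

end IsChordFolding

section
open Filter Topology

/-- The similarity `z ↦ c + w z`. -/
def similarity (c w : ℂ) (hw : w ≠ 0) : ℂ ≃ₜ ℂ :=
  (Homeomorph.mulLeft₀ w hw).trans (Homeomorph.addLeft c)

lemma similarity_apply (c w : ℂ) (hw : w ≠ 0) (z : ℂ) : similarity c w hw z = c + w * z := rfl

lemma dist_similarity (c w : ℂ) (hw : w ≠ 0) (p q : ℂ) :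
    dist (similarity c w hw p) (similarity c w hw q) = ‖w‖ * dist p q := by
  rw [similarity_apply, similarity_apply, dist_add_left, dist_eq_norm, ← mul_sub, norm_mul,
    dist_eq_norm]

lemma dist_inv_mul (w x y : ℂ) : dist (w⁻¹ * x) (w⁻¹ * y) = ‖w‖⁻¹ * dist x y := by
  rw [dist_eq_norm, ← mul_sub, norm_mul, dist_eq_norm, norm_inv]

/-- The closed unit square. -/
def closedSq : Set ℂ := {z | z.re ∈ Icc 0 1 ∧ z.im ∈ Icc 0 1}

lemma interior_closedSq : interior closedSq = openSq := by
  have h : closedSq = Icc 0 1 ×ℂ Icc 0 1 := rfl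
  rw [h, Complex.interior_reProdIm, interior_Icc]
  ext z
  simp only [openSq, Complex.mem_reProdIm, mem_Ioo, mem_ofPred_eq]
  tauto

lemma similarity_combo (c w : ℂ) (hw : w ≠ 0) (p q : ℂ) {α β : ℝ} (h : α + β = 1) :
    similarity c w hw (α • p + β • q) = α • similarity c w hw p + β • similarity c w hw q := by
  obtain rfl : α = 1 - β := by linarith
  simp only [similarity_apply, Complex.real_smul]
  push_cast
  ring

/-- Conjugating a folding by a similarity. -/
lemma FoldedAlong.conj {Ω : Set ℂ} {φ : ℂ → ℂ} {E E' : Set (ℂ → ℝ)} (h : FoldedAlong Ω φ E)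
    {c w : ℂ} (hw : w ≠ 0) (hE : ∀ e ∈ E, (fun z => e (similarity c w hw z)) ∈ E') :
    FoldedAlong (similarity c w hw ⁻¹' Ω) (fun z => w⁻¹ * φ (similarity c w hw z)) E' where
  lip p hp q hq := by
    rw [dist_inv_mul, inv_mul_le_iff₀ (norm_pos_iff.2 hw), ← dist_similarity c w hw]
    exact h.lip _ hp _ hq
  iso p hp q hq hpq := by
    rw [dist_inv_mul, inv_mul_eq_iff_eq_mul₀ (norm_ne_zero_iff.2 hw), ← dist_similarity c w hw]
    exact h.iso _ hp _ hq fun e he => hpq _ (hE e he)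
  frame G h1 h2 h3 h4 := by
    obtain ⟨f, hf⟩ := h.frame (similarity c w hw '' G) ((similarity c w hw).isOpenMap G h1)
      (by
        rintro _ ⟨p, hp, rfl⟩ _ ⟨q, hq, rfl⟩ α β hα hβ hs
        exact ⟨_, h2 hp hq hα hβ hs, similarity_combo c w hw p q hs⟩)
      (image_subset_iff.2 h3)
      (by
        rintro e he _ ⟨z, hz, rfl⟩
        exact h4 _ (hE e he) z hz)
    refine ⟨IsometryEquiv.mk' (fun z => w⁻¹ * f (similarity c w hw z))
      (fun y => (similarity c w hw).symm (f.symm (w * y))) (fun y => ?_)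
      (Isometry.of_dist_eq fun p q => ?_), fun z hz => ?_⟩
    · simp [hw]
    · rw [dist_inv_mul, f.dist_eq, dist_similarity, inv_mul_cancel_left₀ (norm_ne_zero_iff.2 hw)]
    · change w⁻¹ * φ _ = w⁻¹ * f _
      rw [hf (mem_image_of_mem _ hz)]

lemma side_mul (w a b : ℂ) : side (w * a) (w * b) = Complex.normSq w * side a b := by
  simp only [side_eq, Complex.mul_re, Complex.mul_im, Complex.normSq_apply]
  ring

lemma similarity_sub (c w : ℂ) (hw : w ≠ 0) (p q : ℂ) :
    similarity c w hw p - similarity c w hw q = w * (p - q) := by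
  rw [similarity_apply, similarity_apply]
  ring

section
variable {φ : ℂ → ℂ} {c w : ℂ} (hw : w ≠ 0)

lemma interior_similarity_image :
    interior (similarity c w hw '' closedSq) = similarity c w hw '' openSq := by
  rw [← Homeomorph.image_interior, interior_closedSq]

lemma frontier_similarity_image
    (hφ : IsOuterLocalFlatFolding (similarity c w hw '' closedSq) φ) :
    frontier (similarity c w hw '' closedSq) = similarity c w hw '' (closedSq \ openSq) := by
  rw [hφ.compact.isClosed.frontier_eq, interior_similarity_image,
    image_sdiff (similarity c w hw).injective]

lemma isChordFolding_of_square
    (hφ : IsOuterLocalFlatFolding (similarity c w hw '' closedSq) φ)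
    (hfin : {s : Set ℂ | ∃ a b : ℂ, IsCreaseOf (similarity c w hw '' closedSq) φ a b ∧
      s = segment ℝ a b}.Finite) : IsChordFolding (fun z => w⁻¹ * φ (similarity c w hw z))
    fun u v => IsCreaseOf (similarity c w hw '' closedSq) φ (similarity c w hw u)
      (similarity c w hw v) where
  symm u v h := h.symm
  mem u v h := by
    have hu := h.1
    rw [frontier_similarity_image hw hφ, (similarity c w hw).injective.mem_set_image] at hu
    obtain ⟨⟨⟨h1, h2⟩, h3, h4⟩, h5⟩ := hu
    refine ⟨⟨h1, h2⟩, ⟨h3, h4⟩, ?_⟩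
    by_contra! h0
    exact h5 ⟨h1.lt_of_ne' h0.1, h2.lt_of_ne h0.2.1, h3.lt_of_ne' h0.2.2.1, h4.lt_of_ne h0.2.2.2⟩
  mid u v h := by
    have hs : (1 / 2 : ℝ) + 1 / 2 = 1 := by norm_num
    have hm := h.2.2.2.1 ⟨1 / 2, 1 / 2, by norm_num, by norm_num, hs, rfl⟩
    rw [interior_similarity_image, ← similarity_combo c w hw u v hs,
      (similarity c w hw).injective.mem_set_image] at hm
    obtain ⟨h1, h2, h3, h4⟩ := hm
    simp only [Complex.add_re, Complex.add_im, Complex.smul_re, Complex.smul_im, smul_eq_mul] at *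
    refine ⟨⟨?_, ?_⟩, ?_, ?_⟩ <;> linarith
  cross u v u' v' h h' := by
    have := hφ.not_cross h h'
    have hn : 0 < Complex.normSq w := Complex.normSq_pos.2 hw
    simp only [similarity_sub, side_mul] at this
    exact fun h => this ⟨mul_neg_of_pos_of_neg hn h.1, mul_pos hn h.2⟩
  finite := by
    have hinj : Function.Injective (Prod.map (similarity c w hw) (similarity c w hw)) :=
      (similarity c w hw).injective.prodMap (similarity c w hw).injective
    exact (finite_creases hfin).preimage hinj.injOn
  folded E hE := by
    have h := hφ.foldedAlong (E := {e | (fun z => e (similarity c w hw z)) ∈ E}) (by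
      intro u v h
      have hu := h.1
      have hv := h.2.1
      rw [frontier_similarity_image hw hφ] at hu hv
      obtain ⟨u, -, rfl⟩ := hu
      obtain ⟨v, -, rfl⟩ := hv
      obtain ⟨e, he, k, hk, hek⟩ := hE u v h
      have hn : Complex.normSq w ≠ 0 := (Complex.normSq_pos.2 hw).ne'
      refine ⟨fun z => e ((similarity c w hw).symm z), by simpa using he,
        k / Complex.normSq w, div_ne_zero hk hn, fun z => ?_⟩
      obtain ⟨z, rfl⟩ := (similarity c w hw).surjective z
      change e ((similarity c w hw).symm (similarity c w hw z)) = _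
      rw [Homeomorph.symm_apply_apply, hek, similarity_sub, similarity_sub, side_mul]
      field_simp)
    have h' := h.conj hw (E' := E) fun e he => he
    rwa [interior_similarity_image, (similarity c w hw).injective.preimage_image] at h'

lemma exists_height_of_square
    (hφ : IsOuterLocalFlatFolding (similarity c w hw '' closedSq) φ)
    (hfin : {s : Set ℂ | ∃ a b : ℂ, IsCreaseOf (similarity c w hw '' closedSq) φ a b ∧
      s = segment ℝ a b}.Finite) (hH : ∀ b : ℝ × ℝ, IsChordFolding.SpanRange b →
      ¬ IsCreaseOf (similarity c w hw '' closedSq) φ (similarity c w hw ⟨0, b.1⟩)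
        (similarity c w hw ⟨1, b.2⟩)) :
    ∃ η : ℂ → ℝ, ContinuousOn η (interior (similarity c w hw '' closedSq)) ∧
      ∀ p ∈ interior (similarity c w hw '' closedSq),
        ∀ q ∈ interior (similarity c w hw '' closedSq), φ p = φ q → η p = η q → p = q := by
  obtain ⟨η, hη, hinj⟩ := (isChordFolding_of_square hw hφ hfin).exists_height hH
  rw [interior_similarity_image]
  refine ⟨fun z => η ((similarity c w hw).symm z), hη.comp
    (similarity c w hw).symm.continuous.continuousOn ?_, ?_⟩
  · rintro _ ⟨z, hz, rfl⟩
    simpa using hz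
  · rintro _ ⟨p, hp, rfl⟩ _ ⟨q, hq, rfl⟩ h1 h2
    rw [hinj p hp q hq (by rw [h1]) (by simpa using h2)]

end

lemma similarity_rotate (c w : ℂ) (hw : w ≠ 0) (hw' : w * Complex.I ≠ 0) (x y : ℝ) :
    similarity (c + w) (w * Complex.I) hw' ⟨x, y⟩ = similarity c w hw ⟨1 - y, x⟩ := by
  rw [similarity_apply, similarity_apply]
  apply Complex.ext <;> simp <;> ring

lemma similarity_rotate_image (c w : ℂ) (hw : w ≠ 0) (hw' : w * Complex.I ≠ 0) :
    similarity (c + w) (w * Complex.I) hw' '' closedSq = similarity c w hw '' closedSq := by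
  apply Subset.antisymm
  · rintro _ ⟨⟨x, y⟩, ⟨⟨h1, h2⟩, h3, h4⟩, rfl⟩
    simp only at h1 h2 h3 h4
    rw [similarity_rotate c w hw hw']
    exact mem_image_of_mem _ ⟨⟨by simpa using h4, by simpa using h3⟩, h1, h2⟩
  · rintro _ ⟨⟨x, y⟩, ⟨⟨h1, h2⟩, h3, h4⟩, rfl⟩
    simp only at h1 h2 h3 h4
    refine ⟨⟨y, 1 - x⟩, ⟨⟨h3, h4⟩, by simpa using h2, by simpa using h1⟩, ?_⟩
    rw [similarity_rotate c w hw hw', sub_sub_cancel]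

/-- The layers of an outer folding of a square can be separated by a height function. -/
lemma IsSquareRegion.exists_height {K : Set ℂ} {φ : ℂ → ℂ} (hK : IsSquareRegion K)
    (hφ : IsOuterLocalFlatFolding K φ)
    (hfin : {s : Set ℂ | ∃ a b : ℂ, IsCreaseOf K φ a b ∧ s = segment ℝ a b}.Finite) :
    ∃ η : ℂ → ℝ, ContinuousOn η (interior K) ∧
      ∀ p ∈ interior K, ∀ q ∈ interior K, φ p = φ q → η p = η q → p = q := by
  obtain ⟨c, w, hw, rfl⟩ := hK
  change IsOuterLocalFlatFolding (similarity c w hw '' closedSq) φ at hφ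
  by_cases hV : ∃ a : ℝ × ℝ, IsChordFolding.SpanRange a ∧
      IsCreaseOf (similarity c w hw '' closedSq) φ (similarity c w hw ⟨a.1, 0⟩)
        (similarity c w hw ⟨a.2, 1⟩)
  · obtain ⟨a, ha, hac⟩ := hV
    exact exists_height_of_square hw hφ hfin fun b hb =>
      (isChordFolding_of_square hw hφ hfin).not_both_spans ha hac hb
  · have hw' : w * Complex.I ≠ 0 := mul_ne_zero hw Complex.I_ne_zero
    have e := similarity_rotate_image c w hw hw'
    have := exists_height_of_square hw' (φ := φ) (by rwa [e]) (by rw [e]; exact hfin)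
      (fun b ⟨h1, h2, h3, h4⟩ hc => hV ⟨(1 - b.1, 1 - b.2),
        ⟨by simpa using h2, by simpa using h1, by simpa using h4, by simpa using h3⟩, by
          rw [e] at hc
          simpa only [similarity_rotate c w hw hw'] using hc⟩)
    rwa [e] at this

/-- A height function separating the layers of a folding yields embeddings close to it. -/
lemma IsOuterLocalFlatFolding.isOuterGlobalFlatFolding_of_height {K : Set ℂ} {φ : ℂ → ℂ}
    (hφ : IsOuterLocalFlatFolding K φ) {η : ℂ → ℝ} (hη : ContinuousOn η (interior K))
    (hinj : ∀ p ∈ interior K, ∀ q ∈ interior K, φ p = φ q → η p = η q → p = q) :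
    IsOuterGlobalFlatFolding K φ := by
  refine ⟨hφ, fun ε hε => ?_⟩
  obtain ⟨x, hx⟩ := hφ.interior_nonempty
  obtain ⟨δ, hδ, hunif⟩ := Metric.uniformContinuousOn_iff.1
    (hφ.compact.uniformContinuousOn_of_continuous hφ.continuousOn) ε hε
  obtain ⟨R, hR⟩ := hφ.compact.isBounded.subset_closedBall x
  have hR0 : 0 ≤ R := dist_nonneg.trans (hR (interior_subset hx))
  obtain ⟨t, ht0, ht1, htδ⟩ : ∃ t : ℝ, 0 < t ∧ t < 1 ∧ t * R < δ := by
    refine ⟨min (1 / 2) (δ / (R + 1)), by positivity, (min_le_left _ _).trans_lt (by norm_num), ?_⟩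
    calc min (1 / 2) (δ / (R + 1)) * R ≤ δ / (R + 1) * R :=
          mul_le_mul_of_nonneg_right (min_le_right _ _) hR0
      _ < δ := by
          rw [div_mul_eq_mul_div, div_lt_iff₀ (by linarith)]
          nlinarith
  let g : ℂ → ℂ := fun z => t • x + (1 - t) • z
  have hg : Continuous g := by fun_prop
  have hgK : ∀ z ∈ K, g z ∈ interior K := fun z hz =>
    hφ.convex.openSegment_interior_self_subset_interior hx hz
      ⟨t, 1 - t, ht0, by linarith, by ring, rfl⟩
  have hcont : Continuous fun p : K => φ (g p) := by
    have : ContinuousOn (fun z => φ (g z)) K := hφ.continuousOn.comp hg.continuousOn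
      fun z hz => interior_subset (hgK z hz)
    exact continuousOn_iff_continuous_domRestrict.1 this
  have hcont' : Continuous fun p : K => η (g p) := by
    have : ContinuousOn (fun z => η (g z)) K := hη.comp hg.continuousOn hgK
    exact continuousOn_iff_continuous_domRestrict.1 this
  have hcompact : CompactSpace K := isCompact_iff_compactSpace.1 hφ.compact
  let ψ : ℂ → Space3 := fun z => !₂[(φ (g z)).re, (φ (g z)).im, η (g z)]
  refine ⟨ψ, (Continuous.isClosedEmbedding ?_ ?_).isEmbedding, fun p hp => ?_⟩
  · refine (PiLp.continuous_toLp 2 _).comp (continuous_pi fun i => ?_)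
    fin_cases i
    · exact Complex.continuous_re.comp hcont
    · exact Complex.continuous_im.comp hcont
    · exact hcont'
  · intro p q hpq
    have hpq : ψ p = ψ q := hpq
    have h0 : (φ (g p)).re = (φ (g q)).re := congrArg (fun v : Space3 => v 0) hpq
    have h1 : (φ (g p)).im = (φ (g q)).im := congrArg (fun v : Space3 => v 1) hpq
    have h2 : η (g p) = η (g q) := congrArg (fun v : Space3 => v 2) hpq
    have h3 := hinj _ (hgK p p.2) _ (hgK q q.2) (Complex.ext h0 h1) h2
    exact Subtype.ext (smul_right_injective ℂ (sub_ne_zero.2 ht1.ne') (add_left_cancel h3))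
  · have hproj : proj2 (ψ p) = φ (g p) := Complex.ext rfl rfl
    rw [hproj]
    refine (hunif p hp _ (interior_subset (hgK p hp)) ?_).le
    have hd : p - g p = t • (p - x) := by
      simp only [g]
      module
    rw [dist_eq_norm, hd, norm_smul, Real.norm_of_nonneg ht0.le, ← dist_eq_norm]
    exact (mul_le_mul_of_nonneg_left (hR hp) ht0.le).trans_lt htδ

end

theorem stmt16_square_local_global (K : Set ℂ) (φ : ℂ → ℂ) (hK : IsSquareRegion K)
    (hφ : IsOuterLocalFlatFolding K φ)
    (hfin : {s : Set ℂ | ∃ a b : ℂ, IsCreaseOf K φ a b ∧ s = segment ℝ a b}.Finite) :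
    IsOuterGlobalFlatFolding K φ := by
  obtain ⟨η, hη, hinj⟩ := hK.exists_height hφ hfin
  exact hφ.isOuterGlobalFlatFolding_of_height hη hinj
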